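/- arXiv:2005.12953 — 3 statements merged into one kernel-verified Lean document; each statement's English description precedes it below -/
import Mathlib

section
/- Let k be a field, R = k[x,y,z] with 𝔪 = (x,y,z), let d ≥ 3 be an integer and r ≥ 5 an odd integer such that r−1 divides 2d. Then there exists a nonzero polynomial P over k in the r·C(d+2,2) variables Y_{t,α} (1 ≤ t ≤ r, α running over the exponent vectors of degree-d monomials in x,y,z) such that for every r-tuple (f_1,…,f_r) of homogeneous polynomials of degree d in R for which the ideal I = (f_1,…,f_r) is 𝔪-primary with dim_k I_d = r and dim_k Soc(R/I) = 1, the polynomial P vanishes at the point whose (t,α)-coordinate is the coefficient of x^α in f_t. (Hence all codimension-3 Gorenstein ideals generated by r ≥ 5 forms of degree d ≥ 3 are parameterized by a proper Zariski-closed subset; in particular r general forms of degree d ≥ 3 never generate a Gorenstein ideal.) -/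
open MvPolynomial

/-- The maximal graded ideal `𝔪 = (x, y, z)` of `k[x,y,z]`. -/
noncomputable def mIdeal (k : Type*) [Field k] : Ideal (MvPolynomial (Fin 3) k) :=
  Ideal.span (Set.range (X : Fin 3 → MvPolynomial (Fin 3) k))

/-- `dim_k Soc(R/I)`, the total dimension of the socle `(I : 𝔪)/I` of `R/I`. -/
noncomputable def socDim {k : Type*} [Field k] (I : Ideal (MvPolynomial (Fin 3) k)) : ℕ :=
  Module.finrank k
    ↥(Submodule.map (Ideal.Quotient.mkₐ k I).toLinearMap
      ((Submodule.colon I (mIdeal k)).restrictScalars k))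

section GradedPieces

attribute [local instance] MvPolynomial.gradedAlgebra

theorem homogeneousComponent_eq_decompose {σ k : Type*} [CommSemiring k]
    (a : MvPolynomial σ k) (n : ℕ) :
    homogeneousComponent n a = (DirectSum.decompose (homogeneousSubmodule σ k) a n :
      MvPolynomial σ k) :=
  (decomposition.decompose'_apply a n).symm

theorem homogeneousComponent_mul_of_isHomogeneous_right {σ k : Type*} [CommSemiring k]
    {a b : MvPolynomial σ k} {d : ℕ} (hb : b.IsHomogeneous d) (n : ℕ) :
    homogeneousComponent n (a * b) =
      if d ≤ n then homogeneousComponent (n - d) a * b else 0 := by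
  rw [homogeneousComponent_eq_decompose, homogeneousComponent_eq_decompose]
  exact DirectSum.coe_decompose_mul_of_right_mem _ n hb

theorem homogeneousComponent_mem_span {σ k ι : Type*} [CommSemiring k]
    {f : ι → MvPolynomial σ k} {d : ℕ} (hf : ∀ t, (f t).IsHomogeneous d)
    {g : MvPolynomial σ k} (hg : g ∈ Ideal.span (Set.range f)) (n : ℕ) :
    homogeneousComponent n g ∈ Ideal.span (Set.range f) := by
  refine homogeneousComponent_mem_of_mem (Ideal.homogeneous_span _ _ ?_) hg n
  rintro _ ⟨t, rfl⟩
  exact ⟨d, hf t⟩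

end GradedPieces

section Dimensions

variable {k : Type*} [Field k]

instance (n : ℕ) : FiniteDimensional k (homogeneousSubmodule (Fin 3) k n) :=
  Module.Finite.iff_fg.mpr (homogeneousSubmodule_fg _ _ n)

theorem mem_finsuppAntidiag_univ_iff {n : ℕ} {a : Fin 3 →₀ ℕ} :
    a ∈ (Finset.univ : Finset (Fin 3)).finsuppAntidiag n ↔ a.degree = n := by
  simp [Finsupp.degree_eq_sum]

theorem finrank_homogeneousSubmodule (n : ℕ) :
    2 * Module.finrank k (homogeneousSubmodule (Fin 3) k n) = (n + 2) * (n + 1) := by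
  let b : (Finset.univ : Finset (Fin 3)).finsuppAntidiag n → MvPolynomial (Fin 3) k :=
    fun a => monomial a.1 1
  have hb : LinearIndependent k b := by
    have := (basisMonomials (Fin 3) k).linearIndependent.comp
      (Subtype.val : (Finset.univ : Finset (Fin 3)).finsuppAntidiag n → _)
      Subtype.val_injective
    rwa [show b = basisMonomials (Fin 3) k ∘ Subtype.val by ext1 a; simp [b]]
  have hspan : Submodule.span k (Set.range b) = homogeneousSubmodule (Fin 3) k n := by
    apply le_antisymm
    · rw [Submodule.span_le]
      rintro _ ⟨a, rfl⟩
      exact isHomogeneous_monomial _ (mem_finsuppAntidiag_univ_iff.mp a.2)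
    · intro g hg
      rw [g.as_sum]
      refine Submodule.sum_mem _ fun a ha => ?_
      have hdeg : a.degree = n := by
        by_contra h
        exact (mem_support_iff.mp ha) (IsHomogeneous.coeff_eq_zero hg h)
      have : monomial a (coeff a g) = coeff a g • b ⟨a, mem_finsuppAntidiag_univ_iff.mpr hdeg⟩ := by
        simp [b, smul_monomial]
      rw [this]
      exact Submodule.smul_mem _ _ (Submodule.subset_span ⟨_, rfl⟩)
  rw [← hspan, finrank_span_eq_card hb, Fintype.card_coe,
    Finset.card_finsuppAntidiag_nat_eq_choose]
  simp only [Finset.card_univ, Fintype.card_fin]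
  rw [show 3 + n - 1 = n + 2 by omega, Nat.choose_symm_add, Nat.choose_two_right,
    Nat.mul_div_cancel' (Nat.even_mul_pred_self _).two_dvd]
  rfl

/-- The degree-`n` component of `I`, as a subspace of the forms of degree `n`. -/
noncomputable def degreePart (I : Ideal (MvPolynomial (Fin 3) k)) (n : ℕ) :
    Submodule k (homogeneousSubmodule (Fin 3) k n) :=
  (I.restrictScalars k).comap (homogeneousSubmodule (Fin 3) k n).subtype

theorem mem_degreePart {I : Ideal (MvPolynomial (Fin 3) k)} {n : ℕ}
    {g : homogeneousSubmodule (Fin 3) k n} :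
    g ∈ degreePart I n ↔ (g : MvPolynomial (Fin 3) k) ∈ I :=
  Iff.rfl

theorem eq_zero_of_mem_span_of_lt {r d n : ℕ} {f : Fin r → MvPolynomial (Fin 3) k}
    (hf : ∀ t, (f t).IsHomogeneous d) (hn : n < d) {g : MvPolynomial (Fin 3) k}
    (hg : g.IsHomogeneous n) (hgI : g ∈ Ideal.span (Set.range f)) : g = 0 := by
  obtain ⟨c, rfl⟩ := Ideal.mem_span_range_iff_exists_fun.mp hgI
  rw [← homogeneousComponent_eq_self hg, map_sum]
  refine Finset.sum_eq_zero fun t _ => ?_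
  rw [homogeneousComponent_mul_of_isHomogeneous_right (hf t), if_neg (by omega)]

theorem finrank_degreePart_of_lt {r d n : ℕ} {f : Fin r → MvPolynomial (Fin 3) k}
    (hf : ∀ t, (f t).IsHomogeneous d) (hn : n < d) :
    Module.finrank k (degreePart (Ideal.span (Set.range f)) n) = 0 := by
  rw [show degreePart (Ideal.span (Set.range f)) n = ⊥ from ?_, finrank_bot]
  rw [Submodule.eq_bot_iff]
  intro g hg
  exact Subtype.ext (eq_zero_of_mem_span_of_lt hf hn g.2 hg)

theorem finrank_degreePart_le {r d : ℕ} {f : Fin r → MvPolynomial (Fin 3) k}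
    (hf : ∀ t, (f t).IsHomogeneous d) (n : ℕ) :
    Module.finrank k (degreePart (Ideal.span (Set.range f)) (d + n)) ≤
      r * Module.finrank k (homogeneousSubmodule (Fin 3) k n) := by
  let V := homogeneousSubmodule (Fin 3) k
  let Φ : (Fin r → V n) →ₗ[k] MvPolynomial (Fin 3) k :=
    ∑ t, (LinearMap.mulRight k (f t)).comp ((V n).subtype.comp (LinearMap.proj t))
  have hle : (degreePart (Ideal.span (Set.range f)) (d + n)).map (V (d + n)).subtype ≤
      LinearMap.range Φ := by
    rintro _ ⟨g, hg, rfl⟩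
    obtain ⟨c, hc⟩ := Ideal.mem_span_range_iff_exists_fun.mp (mem_degreePart.mp hg)
    refine ⟨fun t => ⟨homogeneousComponent n (c t), homogeneousComponent_mem n _⟩, ?_⟩
    have := homogeneousComponent_eq_self (n := d + n) g.2
    rw [← hc, map_sum] at this
    simp only [homogeneousComponent_mul_of_isHomogeneous_right (hf _), Nat.le_add_right, if_true,
      Nat.add_sub_cancel_left] at this
    simpa [Φ, ← hc] using this
  calc _ = Module.finrank k
        ((degreePart (Ideal.span (Set.range f)) (d + n)).map (V (d + n)).subtype) :=
        (LinearEquiv.finrank_eq (Submodule.equivMapOfInjective _ (V (d + n)).subtype_injective _))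
    _ ≤ Module.finrank k (LinearMap.range Φ) := Submodule.finrank_mono hle
    _ ≤ Module.finrank k (Fin r → V n) := LinearMap.finrank_range_le Φ
    _ = _ := by simp [V, Module.finrank_pi_fintype]

end Dimensions

section Duality

variable {k : Type*} [Field k] {I : Ideal (MvPolynomial (Fin 3) k)}

theorem mem_colon_mIdeal {h : MvPolynomial (Fin 3) k} :
    h ∈ Submodule.colon I (mIdeal k : Set (MvPolynomial (Fin 3) k)) ↔ ∀ i, X i * h ∈ I := by
  rw [Submodule.mem_colon]
  constructor
  · intro H i
    rw [mul_comm]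
    exact H _ (Ideal.subset_span ⟨i, rfl⟩)
  · intro H a ha
    have : mIdeal k ≤ Submodule.comap (LinearMap.mulLeft (MvPolynomial (Fin 3) k) h) I := by
      rw [mIdeal, Ideal.span_le]
      rintro _ ⟨i, rfl⟩
      simpa [mul_comm] using H i
    exact this ha

/-- Multiples of a form outside `I` reach the socle of the quotient. -/
theorem exists_mul_mem_socle (N : ℕ) {u : ℕ} {g : MvPolynomial (Fin 3) k}
    (hg : g.IsHomogeneous u) (hgI : g ∉ I) (hN : ∀ a ∈ mIdeal k ^ N, a * g ∈ I) :
    ∃ (v : ℕ) (m : MvPolynomial (Fin 3) k), m.IsHomogeneous v ∧ m * g ∉ I ∧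
      ∀ i, X i * (m * g) ∈ I := by
  induction N generalizing u g with
  | zero => exact absurd (by simpa using hN 1 (by simp)) hgI
  | succ N ih =>
    by_cases h : ∀ i, X i * g ∈ I
    · exact ⟨0, 1, isHomogeneous_one _ _, by simpa using hgI, by simpa using h⟩
    · push Not at h
      obtain ⟨i, hi⟩ := h
      obtain ⟨v, m, hm, hmI, hs⟩ := ih ((isHomogeneous_X k i).mul hg) hi fun a ha => by
        rw [← mul_assoc]
        refine hN _ ?_
        rw [pow_succ]
        exact Ideal.mul_mem_mul ha (Ideal.subset_span ⟨i, rfl⟩)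
      refine ⟨v + 1, m * X i, hm.mul (isHomogeneous_X k i), ?_, ?_⟩
      · rwa [mul_assoc]
      · simpa only [mul_assoc] using hs

theorem exists_sub_mem_of_socDim_eq_one (hs : socDim I = 1) {a b : MvPolynomial (Fin 3) k}
    (haI : a ∉ I) (ha : ∀ i, X i * a ∈ I) (hb : ∀ i, X i * b ∈ I) :
    ∃ c : k, b - c • a ∈ I := by
  let π := (Ideal.Quotient.mkₐ k I).toLinearMap
  let W := Submodule.map π
    ((Submodule.colon I (mIdeal k : Set (MvPolynomial (Fin 3) k))).restrictScalars k)
  have haW : π a ∈ W := ⟨a, mem_colon_mIdeal.mpr ha, rfl⟩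
  have hbW : π b ∈ W := ⟨b, mem_colon_mIdeal.mpr hb, rfl⟩
  have hne : (⟨π a, haW⟩ : W) ≠ 0 := by
    intro h
    exact haI (Ideal.Quotient.eq_zero_iff_mem.mp (congrArg Subtype.val h))
  obtain ⟨c, hc⟩ := (finrank_eq_one_iff_of_nonzero' _ hne).mp hs ⟨π b, hbW⟩
  refine ⟨c, Ideal.Quotient.eq_zero_iff_mem.mp ?_⟩
  have hc' : c • π a = π b := congrArg Subtype.val hc
  change π (b - c • a) = 0
  rw [map_sub, map_smul, hc', sub_self]

/-- An Artinian graded quotient with one-dimensional socle has a dualizing functional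
concentrated in its socle degree. -/
theorem exists_dualizing_functional
    (hI : ∀ g ∈ I, ∀ n, homogeneousComponent n g ∈ I) {N : ℕ} (hN : mIdeal k ^ N ≤ I)
    (hs : socDim I = 1) :
    ∃ (s : ℕ) (ψ : MvPolynomial (Fin 3) k →ₗ[k] k),
      (∀ g ∈ I, ψ g = 0) ∧ (∃ g, g.IsHomogeneous s ∧ g ∉ I) ∧
      ∀ u g, g.IsHomogeneous u → g ∉ I →
        ∃ v m, u + v = s ∧ m.IsHomogeneous v ∧ ψ (g * m) ≠ 0 := by
  have hreach {u : ℕ} {g : MvPolynomial (Fin 3) k} (hg : g.IsHomogeneous u) (hgI : g ∉ I) :=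
    exists_mul_mem_socle N hg hgI fun a ha => I.mul_mem_right g (hN ha)
  have h1 : (1 : MvPolynomial (Fin 3) k) ∉ I := by
    intro h
    have htop : I = ⊤ := (Ideal.eq_top_iff_one I).mpr h
    subst htop
    have : Subsingleton (MvPolynomial (Fin 3) k ⧸ (⊤ : Ideal (MvPolynomial (Fin 3) k))) :=
      Ideal.Quotient.subsingleton_iff.mpr rfl
    rw [socDim, Module.finrank_zero_of_subsingleton] at hs
    exact zero_ne_one hs
  obtain ⟨s, σ, hσ, hσI, hσs⟩ := hreach (isHomogeneous_one _ _) h1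
  rw [mul_one] at hσI
  simp only [mul_one] at hσs
  obtain ⟨ψ, hψσ, hψ⟩ := Submodule.exists_dual_map_eq_bot_of_notMem
    (p := I.restrictScalars k) hσI inferInstance
  have hψI : ∀ g ∈ I, ψ g = 0 := fun g hg => by
    have : ψ g ∈ (I.restrictScalars k).map ψ := ⟨g, hg, rfl⟩
    rwa [hψ] at this
  refine ⟨s, ψ, hψI, ⟨σ, hσ, hσI⟩, fun u g hg hgI => ?_⟩
  obtain ⟨v, m, hm, hmI, hms⟩ := hreach hg hgI
  obtain ⟨c, hc⟩ := exists_sub_mem_of_socDim_eq_one hs hσI hσs hms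
  have hdeg : v + u = s := by
    by_contra hne
    have := hI _ hc (v + u)
    rw [map_sub, map_smul, homogeneousComponent_eq_self (hm.mul hg),
      homogeneousComponent_of_mem hσ, if_neg hne, smul_zero, sub_zero] at this
    exact hmI this
  refine ⟨v, m, by omega, hm, fun h0 => hmI ?_⟩
  have h2 := hψI _ hc
  rw [map_sub, map_smul, mul_comm m g, h0, zero_sub, neg_eq_zero, smul_eq_mul] at h2
  rcases mul_eq_zero.mp h2 with rfl | h3
  · simpa using hc
  · exact absurd h3 hψσ

theorem finrank_duality {s : ℕ} {ψ : MvPolynomial (Fin 3) k →ₗ[k] k}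
    (hψI : ∀ g ∈ I, ψ g = 0)
    (hψ : ∀ u g, g.IsHomogeneous u → g ∉ I →
      ∃ v m, u + v = s ∧ m.IsHomogeneous v ∧ ψ (g * m) ≠ 0)
    {u v : ℕ} (huv : u + v = s) :
    Module.finrank k (homogeneousSubmodule (Fin 3) k u) + Module.finrank k (degreePart I v) ≤
      Module.finrank k (homogeneousSubmodule (Fin 3) k v) +
        Module.finrank k (degreePart I u) := by
  let V := homogeneousSubmodule (Fin 3) k
  let B : V u →ₗ[k] Module.Dual k (V v) :=
    ((LinearMap.mul k (MvPolynomial (Fin 3) k)).compr₂ ψ).domRestrict₁₂ (V u) (V v)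
  have hB (g : V u) (m : V v) : B g m = ψ (g.1 * m.1) := rfl
  have hker : LinearMap.ker B ≤ degreePart I u := by
    intro g hg
    by_contra hgI
    obtain ⟨v', m, hv', hm, hne⟩ := hψ u g g.2 hgI
    obtain rfl : v' = v := by omega
    exact hne (by simpa [hB] using LinearMap.congr_fun (LinearMap.mem_ker.mp hg) ⟨m, hm⟩)
  have hrange : LinearMap.range B ≤ (degreePart I v).dualAnnihilator := by
    rintro _ ⟨g, rfl⟩
    rw [Submodule.mem_dualAnnihilator]
    intro m hm
    exact hψI _ (I.mul_mem_left _ hm)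
  have h1 : Module.finrank k (LinearMap.ker B) ≤ Module.finrank k (degreePart I u) :=
    Submodule.finrank_mono hker
  have h2 : Module.finrank k (LinearMap.range B) ≤
      Module.finrank k (degreePart I v).dualAnnihilator := Submodule.finrank_mono hrange
  have h3 := LinearMap.finrank_range_add_finrank_ker B
  have h4 : Module.finrank k (degreePart I v) +
      Module.finrank k (degreePart I v).dualAnnihilator = Module.finrank k (V v) :=
    Subspace.finrank_add_finrank_dualAnnihilator_eq (degreePart I v)
  change Module.finrank k (V u) + _ ≤ Module.finrank k (V v) + _
  omega

end Duality

section SocleDegree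

variable {k : Type*} [Field k]

/-- A lower bound for the socle degree, in the form of a monomial outside the ideal. -/
theorem exists_monomial_notMem {r d T : ℕ} {f : Fin r → MvPolynomial (Fin 3) k} (hd : 3 ≤ d)
    (hf : ∀ t, (f t).IsHomogeneous d) {N : ℕ}
    (hN : mIdeal k ^ N ≤ Ideal.span (Set.range f)) (hs : socDim (Ideal.span (Set.range f)) = 1)
    (hT : T ≤ 2 * d - 2 ∨ r = 5 ∧ 2 * T ≤ 5 * d - 6) :
    ∃ a : Fin 3 →₀ ℕ, a.degree = T ∧ monomial a (1 : k) ∉ Ideal.span (Set.range f) := by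
  obtain ⟨s, ψ, hψI, ⟨σ, hσ, hσI⟩, hψ⟩ := exists_dualizing_functional
    (fun g hg n => homogeneousComponent_mem_span hf hg n) hN hs
  have hdual {u v : ℕ} (huv : u + v = s) := finrank_duality hψI hψ huv
  have hTs : T ≤ s := by
    obtain ⟨v, -, hv, -, -⟩ := hψ (d - 1) (X 0 ^ (d - 1)) (isHomogeneous_X_pow 0 (d - 1))
      fun h => pow_ne_zero (d - 1) (X_ne_zero (R := k) (0 : Fin 3))
        (eq_zero_of_mem_span_of_lt hf (by omega) (isHomogeneous_X_pow 0 (d - 1)) h)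
    obtain ⟨e, rfl⟩ : ∃ e, d = e + 2 := ⟨d - 2, by omega⟩
    have hzero := finrank_degreePart_of_lt hf (show e + 2 - 1 < e + 2 by omega)
    have hrank := finrank_homogeneousSubmodule (k := k)
    have hv' : e + 1 ≤ v := by
      by_contra! hlt
      have h1 := hdual hv
      have h2 := hrank (e + 2 - 1)
      have h3 := hrank v
      rw [show e + 2 - 1 = e + 1 by omega] at *
      nlinarith
    rcases hT with hT | ⟨rfl, hT⟩
    · omega
    · obtain rfl | hlt := hv'.eq_or_lt
      · have h1 := hdual (show (e + 2) + e = s by omega)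
        have h2 := hrank (e + 2)
        have h3 := hrank e
        have h4 := finrank_degreePart_le hf 0
        have h5 := hrank 0
        rw [add_zero] at h4
        nlinarith
      · obtain ⟨j, rfl⟩ : ∃ j, v = e + 2 + j := ⟨v - (e + 2), by omega⟩
        have h1 := hdual (show (e + 2 + j) + (e + 2 - 1) = s by omega)
        have h2 := hrank (e + 2 + j)
        have h3 := hrank (e + 2 - 1)
        have h4 := finrank_degreePart_le hf j
        have h5 := hrank j
        rw [show e + 2 - 1 = e + 1 by omega] at *
        have h6 : e ≤ 2 * j + 2 := by
          by_contra! hlt'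
          nlinarith
        omega
  obtain ⟨b, hb, hbI⟩ : ∃ b ∈ σ.support, monomial b (1 : k) ∉ Ideal.span (Set.range f) := by
    by_contra! h
    refine hσI ?_
    rw [σ.as_sum]
    refine Ideal.sum_mem _ fun b hb => ?_
    rw [← mul_one (coeff b σ), ← C_mul_monomial]
    exact Ideal.mul_mem_left _ _ (h b hb)
  have hbs : b.degree = s := by
    by_contra h
    exact (mem_support_iff.mp hb) (hσ.coeff_eq_zero h)
  obtain ⟨a, hab, ha⟩ := Finsupp.exists_le_degree_eq b T (by omega)
  refine ⟨a, ha, fun h => hbI ?_⟩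
  have : monomial b (1 : k) = monomial (b - a) 1 * monomial a 1 := by
    rw [monomial_mul, one_mul, tsub_add_cancel_of_le hab]
  rw [this]
  exact Ideal.mul_mem_left _ _ h

end SocleDegree

section Covering

/-- `m ≤ r` monomials of degree `d` dividing between them every monomial of degree `T` give
`r` such monomials. -/
theorem exists_covering_of_le {m r d T : ℕ} (hm : 0 < m) (hmr : m ≤ r) (L : Fin m → Fin 3 → ℕ)
    (hL : ∀ t, ∑ i, L t i = d)
    (hcov : ∀ a b c : ℕ, a + b + c = T → ∃ t, L t 0 ≤ a ∧ L t 1 ≤ b ∧ L t 2 ≤ c) :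
    ∃ e : Fin r → Fin 3 →₀ ℕ, (∀ t, (e t).degree = d) ∧
      ∀ a : Fin 3 →₀ ℕ, a.degree = T → ∃ t, e t ≤ a := by
  refine ⟨fun t => Finsupp.equivFunOnFinite.symm
    (if h : t.1 < m then L ⟨t, h⟩ else L ⟨0, hm⟩), fun t => ?_, fun a ha => ?_⟩
  · rw [Finsupp.degree_eq_sum]
    simp only [Finsupp.coe_equivFunOnFinite_symm]
    split_ifs <;> exact hL _
  · rw [Finsupp.degree_eq_sum, Fin.sum_univ_three] at ha
    obtain ⟨t, h0, h1, h2⟩ := hcov _ _ _ ha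
    refine ⟨⟨t, t.2.trans_le hmr⟩, fun i => ?_⟩
    fin_cases i <;> simpa

theorem exists_covering_of_six_le {r d : ℕ} (hr : 6 ≤ r) (hd : 3 ≤ d) :
    ∃ e : Fin r → Fin 3 →₀ ℕ, (∀ t, (e t).degree = d) ∧
      ∀ a : Fin 3 →₀ ℕ, a.degree = 2 * d - 2 → ∃ t, e t ≤ a := by
  refine exists_covering_of_le (by omega) hr ![![d, 0, 0], ![0, d, 0], ![0, 0, d],
    ![(d + 1) / 2, d / 2, 0], ![0, (d + 1) / 2, d / 2], ![d / 2, 0, (d + 1) / 2]] ?_ ?_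
  · intro t
    fin_cases t <;> simp [Fin.sum_univ_three] <;> omega
  · intro a b c h
    simp [Fin.exists_fin_succ]
    omega

theorem exists_covering_five {e : ℕ} (he : 2 ≤ e) :
    ∃ m : Fin 5 → Fin 3 →₀ ℕ, (∀ t, (m t).degree = 2 * e) ∧
      ∀ a : Fin 3 →₀ ℕ, a.degree = 5 * e - 3 → ∃ t, m t ≤ a := by
  refine exists_covering_of_le (by omega) le_rfl ![![2 * e, 0, 0], ![0, 2 * e, 0],
    ![0, 0, 2 * e], ![e - 1, e - 1, 2], ![e, e, 0]] ?_ ?_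
  · intro t
    fin_cases t <;> simp [Fin.sum_univ_three] <;> omega
  · intro a b c h
    simp [Fin.exists_fin_succ]
    omega

end Covering

section Minor

/-- If some monomials of degree `d` divide between them every monomial of degree `T`, then a
maximal minor of the multiplication matrix into degree `T` is a nonzero polynomial vanishing at
all tuples of forms whose ideal misses a monomial of degree `T`. -/
theorem exists_minor (k : Type*) [Field k] {r d T : ℕ} (e : Fin r → Fin 3 →₀ ℕ)
    (he : ∀ t, (e t).degree = d)
    (hcov : ∀ a : Fin 3 →₀ ℕ, a.degree = T → ∃ t, e t ≤ a) :
    ∃ P : MvPolynomial (Fin r × ↥(Finset.Nat.antidiagonalTuple 3 d)) k, P ≠ 0 ∧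
      ∀ f : Fin r → MvPolynomial (Fin 3) k, (∀ t, (f t).IsHomogeneous d) →
        (∃ a : Fin 3 →₀ ℕ, a.degree = T ∧
          monomial a (1 : k) ∉ Ideal.span (Set.range f)) →
        MvPolynomial.eval
          (fun p => MvPolynomial.coeff
            (Finsupp.equivFunOnFinite.symm ((p.2 : Fin 3 → ℕ))) (f p.1)) P = 0 := by
  classical
  let D := ↥((Finset.univ : Finset (Fin 3)).finsuppAntidiag T)
  have hD (a : D) : a.1.degree = T := mem_finsuppAntidiag_univ_iff.mp a.2
  choose τ hτ using fun a : D => hcov a.1 (hD a)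
  let E : ↥(Finset.Nat.antidiagonalTuple 3 d) → Fin 3 →₀ ℕ :=
    fun p => Finsupp.equivFunOnFinite.symm p.1
  have hE (p) : (E p).degree = d := by
    rw [Finsupp.degree_eq_sum]
    exact Finset.Nat.mem_antidiagonalTuple.mp p.2
  have hEinj : Function.Injective E := fun p q h =>
    Subtype.ext (Finsupp.equivFunOnFinite.symm.injective h)
  have hEsurj (a : Fin 3 →₀ ℕ) (ha : a.degree = d) : ∃ p, E p = a :=
    ⟨⟨a, Finset.Nat.mem_antidiagonalTuple.mpr (by rwa [Finsupp.degree_eq_sum] at ha)⟩,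
      by ext; simp [E]⟩
  let M : Matrix D D (MvPolynomial (Fin r × ↥(Finset.Nat.antidiagonalTuple 3 d)) k) :=
    fun b a => ∑ p, if E p + (a.1 - e (τ a)) = b.1 then X (τ a, p) else 0
  have heval (f : Fin r → MvPolynomial (Fin 3) k) :
      MvPolynomial.eval (fun p => coeff (E p.2) (f p.1)) M.det =
        Matrix.det (fun b a : D => ∑ p,
          if E p + (a.1 - e (τ a)) = b.1 then coeff (E p) (f (τ a)) else 0) := by
    rw [RingHom.map_det]
    congr 1
    ext b a
    rw [RingHom.mapMatrix_apply, Matrix.map_apply]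
    simp only [M, map_sum]
    refine Finset.sum_congr rfl fun p _ => ?_
    split_ifs
    · exact eval_X _
    · exact map_zero _
  refine ⟨M.det, fun h0 => ?_, fun f hf ⟨a₀, ha₀, haI⟩ => ?_⟩
  · have h1 := heval fun t => monomial (e t) 1
    rw [h0, map_zero] at h1
    refine zero_ne_one (α := k) (h1.trans (Eq.trans ?_ (Matrix.det_one (n := D))))
    congr 1
    ext b a
    obtain ⟨p, hp⟩ := hEsurj (e (τ a)) (he _)
    rw [Finset.sum_eq_single p]
    · rw [hp, add_tsub_cancel_of_le (hτ a), coeff_monomial, if_pos rfl, Matrix.one_apply]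
      by_cases hba : b = a
      · rw [if_pos hba, if_pos (congrArg Subtype.val hba.symm)]
      · rw [if_neg hba, if_neg fun h => hba (Subtype.ext h.symm)]
    · intro q _ hq
      have hcoeff : coeff (E q) (monomial (e (τ a)) (1 : k)) = 0 := by
        rw [coeff_monomial, if_neg]
        rw [← hp]
        exact fun h => hq (hEinj h.symm)
      rw [hcoeff, ite_self]
    · exact fun h => absurd (Finset.mem_univ p) h
  · refine (heval f).trans ?_
    obtain ⟨ψ, hψa, hψ⟩ := Submodule.exists_dual_map_eq_bot_of_notMem
      (p := (Ideal.span (Set.range f)).restrictScalars k) haI inferInstance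
    have hψI : ∀ g ∈ Ideal.span (Set.range f), ψ g = 0 := fun g hg => by
      have : ψ g ∈ ((Ideal.span (Set.range f)).restrictScalars k).map ψ := ⟨g, hg, rfl⟩
      rwa [hψ] at this
    refine Matrix.exists_vecMul_eq_zero_iff.mp ⟨fun b => ψ (monomial b.1 1), ?_, ?_⟩
    · intro h
      exact hψa (congrFun h ⟨a₀, mem_finsuppAntidiag_univ_iff.mpr ha₀⟩)
    · ext a
      have hsum : f (τ a) = ∑ p, monomial (E p) (coeff (E p) (f (τ a))) := by
        ext c
        rw [coeff_sum]
        simp only [coeff_monomial]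
        by_cases hc : c.degree = d
        · obtain ⟨p, rfl⟩ := hEsurj c hc
          simp [hEinj.eq_iff]
        · rw [(hf _).coeff_eq_zero hc, Finset.sum_eq_zero]
          intro p _
          rw [if_neg]
          rintro rfl
          exact hc (hE p)
      have hzero := hψI (f (τ a) * monomial (a.1 - e (τ a)) 1)
        (Ideal.mul_mem_right _ _ (Ideal.subset_span ⟨_, rfl⟩))
      rw [hsum, Finset.sum_mul, map_sum] at hzero
      simp only [Matrix.vecMul, dotProduct, Pi.zero_apply, Finset.mul_sum]
      rw [Finset.sum_comm]
      refine Eq.trans ?_ hzero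
      refine Finset.sum_congr rfl fun p _ => ?_
      have hdeg : (E p + (a.1 - e (τ a))).degree = T := by
        have h1 : (e (τ a) + (a.1 - e (τ a))).degree = T := by
          rw [add_tsub_cancel_of_le (hτ a), hD]
        rw [map_add, he] at h1
        rw [map_add, hE, h1]
      rw [Finset.sum_eq_single
        (⟨E p + (a.1 - e (τ a)), mem_finsuppAntidiag_univ_iff.mpr hdeg⟩ : D)]
      · rw [if_pos rfl, monomial_mul, mul_one,
          ← mul_one (coeff (E p) (f (τ a))), ← smul_eq_mul (coeff (E p) (f (τ a))) 1,
          ← smul_monomial, map_smul, smul_eq_mul, smul_eq_mul, mul_one, mul_comm]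
      · intro b _ hb
        rw [if_neg, mul_zero]
        exact fun h => hb (Subtype.ext h.symm)
      · exact fun h => absurd (Finset.mem_univ _) h

end Minor

/-- For `d ≥ 3` and odd `r ≥ 5` with `r−1 ∣ 2d`, there is a nonzero polynomial `P` in the
`r·C(d+2,2)` variables `Y_{t,α}` vanishing at the coefficient point of every `r`-tuple of
degree-`d` forms `f_1,…,f_r ∈ k[x,y,z]` generating an `𝔪`-primary ideal with
`dim_k I_d = r` and 1-dimensional socle: codimension-3 Gorenstein ideals generated by
`r ≥ 5` forms of degree `d ≥ 3` are parameterized by a proper Zariski-closed subset. -/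
theorem stmt6 (k : Type*) [Field k] (d r : ℕ) (hd : 3 ≤ d) (hr : 5 ≤ r) (hodd : Odd r)
    (hdvd : (r - 1) ∣ 2 * d) :
    ∃ P : MvPolynomial (Fin r × ↥(Finset.Nat.antidiagonalTuple 3 d)) k, P ≠ 0 ∧
      ∀ f : Fin r → MvPolynomial (Fin 3) k, (∀ t, (f t).IsHomogeneous d) →
        (∃ N : ℕ, 1 ≤ N ∧ (mIdeal k) ^ N ≤ Ideal.span (Set.range f)) →
        Module.finrank k
          ↥((Ideal.span (Set.range f)).restrictScalars k ⊓
            homogeneousSubmodule (Fin 3) k d) = r →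
        socDim (Ideal.span (Set.range f)) = 1 →
        MvPolynomial.eval
          (fun p => MvPolynomial.coeff
            (Finsupp.equivFunOnFinite.symm ((p.2 : Fin 3 → ℕ))) (f p.1)) P = 0 := by
  obtain ⟨T, hT, e, he, hcov⟩ : ∃ T, (T ≤ 2 * d - 2 ∨ r = 5 ∧ 2 * T ≤ 5 * d - 6) ∧
      ∃ e : Fin r → Fin 3 →₀ ℕ, (∀ t, (e t).degree = d) ∧
        ∀ a : Fin 3 →₀ ℕ, a.degree = T → ∃ t, e t ≤ a := by
    obtain rfl | hr' := hr.eq_or_lt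
    · obtain ⟨c, hc⟩ := hdvd
      obtain rfl : d = 2 * c := by omega
      exact ⟨5 * c - 3, Or.inr ⟨rfl, by omega⟩, exists_covering_five (by omega)⟩
    · exact ⟨2 * d - 2, Or.inl le_rfl, exists_covering_of_six_le hr' hd⟩
  obtain ⟨P, hP, hvanish⟩ := exists_minor k e he hcov
  refine ⟨P, hP, fun f hf ⟨N, _, hN⟩ _ hs => hvanish f hf ?_⟩
  exact exists_monomial_notMem hd hf hN hs hT
end

section
/- Let k be a field and let I ⊆ R = k[x,y,z] be a proper homogeneous 𝔪-primary ideal with dim_k Soc(R/I) = 1 which is generated by its degree-d homogeneous component (d ≥ 1), and set r := dim_k I_d. Then r ≥ 3 is odd, r−1 divides 2d, and, setting d' := 2d/(r−1), the socle degree of R/I (the largest t with (R/I)_t ≠ 0) equals 2d + d' − 3. -/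
open MvPolynomial

section LinearAlgebra

open Module

variable {k V W : Type*} [Field k] [AddCommGroup V] [Module k V] [AddCommGroup W] [Module k W]

/-- A bilinear form and its flip have the same rank. -/
theorem finrank_range_flip [FiniteDimensional k W]
    (B : V →ₗ[k] W →ₗ[k] k) :
    finrank k (LinearMap.range B.flip) = finrank k (LinearMap.range B) := by
  have h : B.flip = B.dualMap ∘ₗ (evalEquiv k W).toLinearMap := by
    ext w v
    rfl
  rw [h, LinearMap.range_comp_of_range_eq_top _ (LinearEquiv.range _),
    LinearMap.finrank_range_dualMap_eq_finrank_range]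

/-- The rank of an alternating bilinear form is even. -/
theorem LinearMap.IsAlt.even_finrank_range [FiniteDimensional k V]
    {B : V →ₗ[k] V →ₗ[k] k} (hB : B.IsAlt) : Even (finrank k (LinearMap.range B)) := by
  induction hn : finrank k V using Nat.strong_induction_on generalizing V with
  | _ n ih =>
  by_cases h0 : B = 0
  · rw [h0, LinearMap.range_zero, finrank_bot]; exact Even.zero
  obtain ⟨u, v, huv⟩ : ∃ u v, B u v = 1 := by
    by_contra! h
    refine h0 (LinearMap.ext₂ fun u v => ?_)
    by_contra hne
    exact h u ((B u v)⁻¹ • v) (by simpa using inv_mul_cancel₀ hne)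
  have hvu : B v u = -1 := by rw [← huv, ← hB.neg u v]
  set f : V →ₗ[k] k × k := (B u).prod (B v) with hf
  have hfs : LinearMap.range f = ⊤ := by
    rw [LinearMap.range_eq_top]
    rintro ⟨a, b⟩
    exact ⟨a • v - b • u, by simp [hf, huv, hvu, hB.self_eq_zero]⟩
  set U := LinearMap.ker f
  have hdim : 1 + 1 + finrank k U = finrank k V := by
    rw [← f.finrank_range_add_finrank_ker, hfs, finrank_top, finrank_prod, finrank_self]
  set B' : U →ₗ[k] U →ₗ[k] k := B.domRestrict₁₂ U U with hB'
  have hU : ∀ x, x ∈ U ↔ B u x = 0 ∧ B v x = 0 := fun x => by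
    simp [U, hf]
  have hker : (LinearMap.ker B').map U.subtype = LinearMap.ker B := by
    ext x
    simp only [Submodule.mem_map, LinearMap.mem_ker, Submodule.subtype_apply, Subtype.exists,
      exists_and_right, exists_eq_right]
    constructor
    · rintro ⟨hx, h⟩
      ext y
      have hxu : B x u = 0 := by rw [← hB.neg, ((hU x).1 hx).1, neg_zero]
      have hxv : B x v = 0 := by rw [← hB.neg, ((hU x).1 hx).2, neg_zero]
      have hy : y - B u y • v + B v y • u ∈ U := by
        rw [hU]
        simp [huv, hvu, hB.self_eq_zero]
      have := LinearMap.congr_fun h ⟨_, hy⟩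
      simpa [hB', LinearMap.domRestrict₁₂_apply, hxu, hxv] using this
    · intro h
      refine ⟨(hU x).2 ⟨?_, ?_⟩, ?_⟩
      · rw [← hB.neg, h]; simp
      · rw [← hB.neg, h]; simp
      · ext y
        simp [hB', LinearMap.domRestrict₁₂_apply, h]
  have hker' : finrank k (LinearMap.ker B') = finrank k (LinearMap.ker B) := by
    rw [← hker, Submodule.finrank_map_subtype_eq]
  have h1 := B.finrank_range_add_finrank_ker
  have h2 := B'.finrank_range_add_finrank_ker
  have h3 := ih (finrank k U) (by omega) (B := B') (fun x => hB x) rfl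
  have h4 : finrank k (LinearMap.range B) = finrank k (LinearMap.range B') + 2 := by omega
  rw [h4]
  exact h3.add (by decide)

/-- The dimension of a subspace is the sum of those of its image and its intersection with the
kernel of a linear map. -/
theorem Submodule.finrank_map_add_finrank_ker_inf (f : V →ₗ[k] W) (P : Submodule k V)
    [FiniteDimensional k P] :
    finrank k (P.map f) + finrank k (LinearMap.ker f ⊓ P : Submodule k V) = finrank k P := by
  rw [← (f.domRestrict P).finrank_range_add_finrank_ker, LinearMap.range_domRestrict,
    LinearMap.ker_domRestrict, ← Submodule.finrank_map_subtype_eq, Submodule.map_comap_subtype,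
    inf_comm]

/-- If a pairing detects the nonzero elements of the image of `P` under `f`, then its rank on `P`
is the dimension of that image. -/
theorem finrank_range_domRestrict_comp {V' : Type*} [AddCommGroup V'] [Module k V']
    (f : V →ₗ[k] W) (B : W →ₗ[k] V' →ₗ[k] k) (P : Submodule k V) [FiniteDimensional k P]
    (Q : Submodule k V') (h : ∀ x ∈ P, f x ≠ 0 → ∃ y ∈ Q, B (f x) y ≠ 0) :
    finrank k (LinearMap.range ((B ∘ₗ f).domRestrict₁₂ P Q)) = finrank k (P.map f) := by
  have hker : LinearMap.ker ((B ∘ₗ f).domRestrict₁₂ P Q) = LinearMap.ker (f.domRestrict P) := by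
    ext x
    rw [LinearMap.mem_ker, LinearMap.mem_ker, LinearMap.domRestrict_apply]
    constructor
    · intro hx
      by_contra h0
      obtain ⟨y, hy, hxy⟩ := h x x.2 h0
      exact hxy (LinearMap.congr_fun hx ⟨y, hy⟩)
    · intro hx
      ext y
      simp [LinearMap.domRestrict₁₂_apply, hx]
  have h1 := ((B ∘ₗ f).domRestrict₁₂ P Q).finrank_range_add_finrank_ker
  have h2 := (f.domRestrict P).finrank_range_add_finrank_ker
  rw [hker] at h1
  rw [LinearMap.range_domRestrict] at h2
  omega

theorem Submodule.pi_const_eq_range (P : Submodule k V) (n : ℕ) :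
    Submodule.pi Set.univ (fun _ : Fin n => P) = LinearMap.range (P.subtype.compLeft (Fin n)) := by
  ext v
  constructor
  · intro hv
    exact ⟨fun i => ⟨v i, hv i trivial⟩, rfl⟩
  · rintro ⟨w, rfl⟩ i -
    exact (w i).2

theorem Submodule.finiteDimensional_pi_const (P : Submodule k V) [FiniteDimensional k P] (n : ℕ) :
    FiniteDimensional k (Submodule.pi Set.univ fun _ : Fin n => P) := by
  rw [Submodule.pi_const_eq_range]
  infer_instance

theorem Submodule.finrank_pi_const (P : Submodule k V) [FiniteDimensional k P] (n : ℕ) :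
    finrank k (Submodule.pi Set.univ fun _ : Fin n => P) = n * finrank k P := by
  rw [Submodule.pi_const_eq_range, LinearMap.finrank_range_of_inj, finrank_pi_fintype]
  · simp
  · intro v w hvw
    ext i
    exact congrFun hvw i

end LinearAlgebra

section Arithmetic

theorem max_second_difference (x : ℤ) :
    max (x + 2) 0 - 2 * max (x + 1) 0 + max x 0 = if x + 1 = 0 then 1 else 0 := by
  split_ifs <;> omega

/-- Let `h` be a symmetric function whose third difference is concentrated in the degrees
`0`, `d`, `s + 3 - d`, `s + 3`. Then the first difference of `h` is determined by `r = -Δ³h(d)`. -/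
theorem first_difference_eq {h : ℤ → ℤ} {s d r : ℤ} (hneg : ∀ t < 0, h t = 0)
    (hsym : ∀ t, h (s - t) = h t) (h0 : h 0 = 1)
    (hK : ∀ j, j ≠ 0 → j ≠ d → j ≠ s + 3 - d → j ≠ s + 3 →
      h j - 3 * h (j - 1) + 3 * h (j - 2) - h (j - 3) = 0)
    (hd : 1 ≤ d) (hds : d ≤ s + 1) (hr : 0 < r)
    (hKd : h d - 3 * h (d - 1) + 3 * h (d - 2) - h (d - 3) = -r) (n : ℕ) :
    h n - h (n - 1) = max (n + 1 : ℤ) 0 - r * max (n + 1 - d) 0 + r * max (n + 1 - (s + 3 - d)) 0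
      - max (n + 1 - (s + 3)) 0 := by
  have hKsym : ∀ j, h (s + 3 - j) - 3 * h (s + 3 - j - 1) + 3 * h (s + 3 - j - 2)
      - h (s + 3 - j - 3) = -(h j - 3 * h (j - 1) + 3 * h (j - 2) - h (j - 3)) := fun j => by
    have e0 := hsym j
    have e1 := hsym (j - 1)
    have e2 := hsym (j - 2)
    have e3 := hsym (j - 3)
    rw [show s - (j - 1) = s + 3 - j - 2 by ring] at e1
    rw [show s - (j - 2) = s + 3 - j - 1 by ring] at e2
    rw [show s - (j - 3) = s + 3 - j by ring] at e3
    rw [show s - j = s + 3 - j - 3 by ring] at e0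
    linarith
  have hK0 : h 0 - 3 * h (0 - 1) + 3 * h (0 - 2) - h (0 - 3) = 1 := by
    rw [h0, hneg _ (by norm_num), hneg _ (by norm_num), hneg _ (by norm_num)]
    norm_num
  have hKs := hKsym 0
  rw [hK0, sub_zero] at hKs
  have hKe := hKsym d
  rw [hKd] at hKe
  have hed : s + 3 - d ≠ d := fun h => by rw [h] at hKe; omega
  have key : ∀ j, h j - 3 * h (j - 1) + 3 * h (j - 2) - h (j - 3) =
      (if j = 0 then 1 else 0) - r * (if j - d = 0 then 1 else 0)
      + r * (if j - (s + 3 - d) = 0 then 1 else 0) - (if j - (s + 3) = 0 then 1 else 0) := by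
    intro j
    by_cases j0 : j = 0
    · subst j0
      rw [hK0, if_pos rfl, if_neg (by omega), if_neg (by omega), if_neg (by omega)]
      ring
    by_cases jd : j = d
    · subst jd
      rw [hKd, if_neg (by omega), if_pos (by omega), if_neg (by omega), if_neg (by omega)]
      ring
    by_cases je : j = s + 3 - d
    · subst je
      rw [hKe, if_neg (by omega), if_neg (by omega), if_pos (by omega), if_neg (by omega)]
      ring
    by_cases js : j = s + 3
    · subst js
      rw [hKs, if_neg (by omega), if_neg (by omega), if_neg (by omega), if_pos (by omega)]
      ring
    rw [hK j j0 jd je js, if_neg (by omega), if_neg (by omega), if_neg (by omega),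
      if_neg (by omega)]
    ring
  have step : ∀ m : ℤ,
      (h (m - 1) - h (m - 1 - 1) = max (m - 1 + 1) 0 - r * max (m - 1 + 1 - d) 0
        + r * max (m - 1 + 1 - (s + 3 - d)) 0 - max (m - 1 + 1 - (s + 3)) 0) →
      (h m - h (m - 1) = max (m + 1) 0 - r * max (m + 1 - d) 0
        + r * max (m + 1 - (s + 3 - d)) 0 - max (m + 1 - (s + 3)) 0) →
      (h (m + 1) - h m = max (m + 1 + 1) 0 - r * max (m + 1 + 1 - d) 0
        + r * max (m + 1 + 1 - (s + 3 - d)) 0 - max (m + 1 + 1 - (s + 3)) 0) := by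
    intro m h1 h2
    have k := key (m + 1)
    have p0 := max_second_difference m
    have p1 := max_second_difference (m - d)
    have p2 := max_second_difference (m - (s + 3 - d))
    have p3 := max_second_difference (m - (s + 3))
    rw [show m + 1 - d = m - d + 1 by ring, show m + 1 - (s + 3 - d) = m - (s + 3 - d) + 1 by ring,
      show m + 1 - (s + 3) = m - (s + 3) + 1 by ring, ← p0, ← p1, ← p2, ← p3,
      show m + 1 - 1 = m by ring, show m + 1 - 2 = m - 1 by ring,
      show m + 1 - 3 = m - 1 - 1 by ring] at k
    ring_nf at h1 h2 k ⊢
    linarith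
  have main : ∀ n : ℕ,
      (h ((n : ℤ) - 1) - h ((n : ℤ) - 1 - 1) = max ((n : ℤ) - 1 + 1) 0
        - r * max ((n : ℤ) - 1 + 1 - d) 0
        + r * max ((n : ℤ) - 1 + 1 - (s + 3 - d)) 0 - max ((n : ℤ) - 1 + 1 - (s + 3)) 0) ∧
      (h n - h (n - 1) = max (n + 1 : ℤ) 0 - r * max (n + 1 - d) 0
        + r * max (n + 1 - (s + 3 - d)) 0 - max (n + 1 - (s + 3)) 0) := by
    intro n
    induction n with
    | zero =>
      rw [Nat.cast_zero, hneg (0 - 1) (by norm_num), hneg (0 - 1 - 1) (by norm_num), h0]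
      rw [max_eq_right (a := 0 - 1 + 1 - d) (by omega), max_eq_right (a := 0 + 1 - d) (by omega),
        max_eq_right (a := 0 - 1 + 1 - (s + 3 - d)) (by omega),
        max_eq_right (a := 0 + 1 - (s + 3 - d)) (by omega),
        max_eq_right (a := 0 - 1 + 1 - (s + 3)) (by omega),
        max_eq_right (a := 0 + 1 - (s + 3)) (by omega)]
      constructor <;> norm_num
    | succ n ih =>
      have := step n ih.1 ih.2
      rw [Nat.cast_succ, add_sub_cancel_right]
      exact ⟨ih.2, this⟩
  exact (main n).2

/-- The numerical consequences of a symmetric `h` having third difference concentrated in the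
degrees `0`, `d`, `s + 3 - d`, `s + 3`, with a parity constraint in the middle degree. -/
theorem numerical_consequences {h : ℤ → ℤ} {s d r : ℤ} (hneg : ∀ t < 0, h t = 0)
    (hsym : ∀ t, h (s - t) = h t) (h0 : h 0 = 1)
    (hK : ∀ j, j ≠ 0 → j ≠ d → j ≠ s + 3 - d → j ≠ s + 3 →
      h j - 3 * h (j - 1) + 3 * h (j - 2) - h (j - 3) = 0)
    (hd : 1 ≤ d) (hds : d ≤ s + 1) (hr : 0 < r)
    (hKd : h d - 3 * h (d - 1) + 3 * h (d - 2) - h (d - 3) = -r)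
    (hpar : ∀ j, j ≠ 0 → j ≠ d → s + 3 = 2 * j → Even (3 * h (j - 1) - h j)) :
    (r - 1) * (s + 3) = 2 * r * d ∧ Odd r := by
  have hfd := first_difference_eq hneg hsym h0 hK hd hds hr hKd
  have heq : (r - 1) * (s + 3) = 2 * r * d := by
    have hlarge := hfd (s + 2).toNat
    rw [Int.toNat_of_nonneg (by omega), ← hsym (s + 2), hneg (s - (s + 2)) (by omega),
      ← hsym (s + 2 - 1), hneg (s - (s + 2 - 1)) (by omega), max_eq_left (by omega),
      max_eq_left (by omega), max_eq_left (by omega), max_eq_right (by omega)] at hlarge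
    linarith
  refine ⟨heq, ?_⟩
  rcases Int.even_or_odd s with hs | hs
  · have h3 : Odd (s + 3) := hs.add_odd (by decide)
    have : Even ((r - 1) * (s + 3)) := by rw [heq, mul_assoc]; exact even_two_mul _
    rcases Int.even_mul.1 this with h1 | h1
    · simpa using h1.add_odd odd_one
    · exact absurd h1 (Int.not_even_iff_odd.2 h3)
  · obtain ⟨c, hc⟩ := hs
    obtain ⟨j, rfl⟩ : ∃ j, s = 2 * j - 3 := ⟨c + 2, by omega⟩
    have hjd : d < j := by
      have h1 : (r - 1) * (2 * (j - d)) = 2 * d := by linarith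
      by_contra hcon
      nlinarith
    have hjr : (r - 1) * j = r * d := by linarith
    have hj := hfd j.toNat
    rw [Int.toNat_of_nonneg (by omega), max_eq_left (by omega), max_eq_left (by omega),
      max_eq_right (a := j + 1 - (2 * j - 3 + 3 - d)) (by omega),
      max_eq_right (by omega)] at hj
    have h2 : r = 3 * h (j - 1) - h j + (2 * -h (j - 1) + 1) := by linarith
    rw [h2]
    exact (hpar j (by omega) (by omega) (by ring)).add_odd (odd_two_mul_add_one _)

end Arithmetic

section Polynomial

open Matrix Module

/-- The component of degree `t` of `k[x,y,z]`, for an arbitrary integer `t`. -/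
noncomputable abbrev gr (k : Type*) [Field k] (t : ℤ) : Submodule k (MvPolynomial (Fin 3) k) :=
  weightedHomogeneousSubmodule k (fun _ : Fin 3 => (1 : ℤ)) t

/-- The projection of `k[x,y,z]` to its component of degree `t`. -/
noncomputable abbrev grProj (k : Type*) [Field k] (t : ℤ) :
    MvPolynomial (Fin 3) k →ₗ[k] MvPolynomial (Fin 3) k :=
  weightedHomogeneousComponent (fun _ : Fin 3 => (1 : ℤ)) t

variable {k : Type*} [Field k]

theorem weight_one_int (m : Fin 3 →₀ ℕ) :
    Finsupp.weight (fun _ : Fin 3 => (1 : ℤ)) m = (m.degree : ℤ) := by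
  simp [Finsupp.weight_apply, Finsupp.degree_eq_sum, Finsupp.sum_fintype]

theorem mem_gr_natCast {n : ℕ} {p : MvPolynomial (Fin 3) k} :
    p ∈ gr k n ↔ p.IsHomogeneous n := by
  simp only [mem_weightedHomogeneousSubmodule, IsHomogeneous, IsWeightedHomogeneous,
    weight_one_int, Nat.cast_inj, Finsupp.degree_eq_weight_one]
  rfl

theorem homogeneousSubmodule_eq_gr (n : ℕ) : homogeneousSubmodule (Fin 3) k n = gr k n := by
  ext p
  rw [mem_gr_natCast, mem_homogeneousSubmodule]

theorem gr_of_neg {t : ℤ} (ht : t < 0) : gr k t = ⊥ := by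
  rw [eq_bot_iff]
  intro p hp
  rw [Submodule.mem_bot]
  by_contra h0
  obtain ⟨m, hm⟩ := exists_coeff_ne_zero h0
  have := hp hm
  rw [weight_one_int] at this
  omega

theorem X_mem_gr (i : Fin 3) : (X i : MvPolynomial (Fin 3) k) ∈ gr k 1 :=
  isWeightedHomogeneous_X k _ i

theorem mul_mem_gr {s t : ℤ} {p q : MvPolynomial (Fin 3) k} (hp : p ∈ gr k s) (hq : q ∈ gr k t) :
    p * q ∈ gr k (s + t) :=
  IsWeightedHomogeneous.mul hp hq

theorem X_mul_mem_gr {t : ℤ} {p : MvPolynomial (Fin 3) k} (i : Fin 3) (hp : p ∈ gr k (t - 1)) :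
    X i * p ∈ gr k t := by
  simpa using mul_mem_gr (X_mem_gr i) hp

theorem grProj_mem (t : ℤ) (p : MvPolynomial (Fin 3) k) : grProj k t p ∈ gr k t :=
  weightedHomogeneousComponent_mem _ p t

theorem grProj_of_mem {t : ℤ} {p : MvPolynomial (Fin 3) k} (hp : p ∈ gr k t) :
    grProj k t p = p :=
  weightedHomogeneousComponent_eq_self hp

theorem grProj_of_mem_ne {s t : ℤ} {p : MvPolynomial (Fin 3) k} (hp : p ∈ gr k s) (h : t ≠ s) :
    grProj k t p = 0 := by
  rw [grProj, weightedHomogeneousComponent_of_mem hp, if_neg h]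

theorem grProj_X_mul (t : ℤ) (i : Fin 3) (p : MvPolynomial (Fin 3) k) :
    grProj k t (X i * p) = X i * grProj k (t - 1) p := by
  let _ := weightedGradedAlgebra k (fun _ : Fin 3 => (1 : ℤ))
  have := DirectSum.coe_decompose_mul_add_of_left_mem (gr k) (j := t - 1) (b := p)
    (X_mem_gr (k := k) i)
  rw [add_sub_cancel] at this
  have e : ∀ (q : MvPolynomial (Fin 3) k) (j : ℤ),
      (DirectSum.decompose (gr k) q j : MvPolynomial (Fin 3) k) = grProj k j q :=
    fun q j => decompose'_apply k _ q j
  rwa [e, e] at this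

theorem grProj_mem_of_mem {I : Ideal (MvPolynomial (Fin 3) k)} {d : ℤ}
    {S : Set (MvPolynomial (Fin 3) k)} (hS : S ⊆ gr k d) (hI : I = Ideal.span S)
    {p : MvPolynomial (Fin 3) k} (hp : p ∈ I) (t : ℤ) : grProj k t p ∈ I := by
  let _ := weightedGradedAlgebra k (fun _ : Fin 3 => (1 : ℤ))
  refine weightedHomogeneousComponent_mem_of_mem k _ ?_ hp t
  rw [hI]
  exact Ideal.homogeneous_span _ _ fun x hx => ⟨d, hS hx⟩

/-- In an ideal generated in degree `d`, every component of degree other than `d` is generated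
by the component of the preceding degree. -/
theorem exists_eq_sum_X_mul {I : Ideal (MvPolynomial (Fin 3) k)} {d : ℤ}
    {S : Set (MvPolynomial (Fin 3) k)} (hS : S ⊆ gr k d) (hI : I = Ideal.span S)
    {t : ℤ} (ht : t ≠ d) {p : MvPolynomial (Fin 3) k} (hp : p ∈ I) (hpt : p ∈ gr k t) :
    ∃ g : Fin 3 → MvPolynomial (Fin 3) k,
      (∀ i, g i ∈ I ∧ g i ∈ gr k (t - 1)) ∧ X ⬝ᵥ g = p := by
  suffices key : ∀ p ∈ I, ∃ g : Fin 3 → MvPolynomial (Fin 3) k,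
      (∀ i, g i ∈ I ∧ g i ∈ gr k (t - 1)) ∧ X ⬝ᵥ g = grProj k t p by
    simpa [grProj_of_mem hpt] using key p hp
  have zero : ∃ g : Fin 3 → MvPolynomial (Fin 3) k,
      (∀ i, g i ∈ I ∧ g i ∈ gr k (t - 1)) ∧ X ⬝ᵥ g = 0 :=
    ⟨0, fun i => ⟨zero_mem _, zero_mem _⟩, by simp⟩
  have add : ∀ p q : MvPolynomial (Fin 3) k,
      (∃ g : Fin 3 → MvPolynomial (Fin 3) k,
        (∀ i, g i ∈ I ∧ g i ∈ gr k (t - 1)) ∧ X ⬝ᵥ g = p) →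
      (∃ g : Fin 3 → MvPolynomial (Fin 3) k,
        (∀ i, g i ∈ I ∧ g i ∈ gr k (t - 1)) ∧ X ⬝ᵥ g = q) →
      ∃ g : Fin 3 → MvPolynomial (Fin 3) k,
        (∀ i, g i ∈ I ∧ g i ∈ gr k (t - 1)) ∧ X ⬝ᵥ g = p + q := by
    rintro p q ⟨g, hg, rfl⟩ ⟨g', hg', rfl⟩
    exact ⟨g + g', fun i => ⟨add_mem (hg i).1 (hg' i).1, add_mem (hg i).2 (hg' i).2⟩,
      dotProduct_add _ _ _⟩
  intro p hp
  have hp' := hp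
  rw [hI] at hp'
  induction hp' using Submodule.span_induction with
  | mem x hx => rwa [grProj_of_mem_ne (hS hx) ht]
  | zero => rwa [map_zero]
  | add x y hx hy ihx ihy =>
    rw [map_add]
    rw [Ideal.submodule_span_eq, ← hI] at hx hy
    exact add _ _ (ihx hx) (ihy hy)
  | smul a x hx ih =>
    rw [Ideal.submodule_span_eq, ← hI] at hx
    obtain ⟨g, hg, hgx⟩ := ih hx
    clear hp
    rw [smul_eq_mul]
    induction a using MvPolynomial.induction_on with
    | C c =>
      refine ⟨c • g, fun i => ⟨?_, Submodule.smul_mem _ c (hg i).2⟩, ?_⟩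
      · exact (I.restrictScalars k).smul_mem c (hg i).1
      · rw [C_mul', map_smul, ← hgx, dotProduct_smul]
    | add a b iha ihb =>
      rw [add_mul, map_add]
      exact add _ _ iha ihb
    | mul_X a i _ =>
      rw [mul_comm a, mul_assoc, grProj_X_mul]
      refine ⟨Pi.single i (grProj k (t - 1) (a * x)), fun j => ?_, by simp⟩
      rcases eq_or_ne j i with rfl | hj
      · rw [Pi.single_eq_same]
        exact ⟨grProj_mem_of_mem hS hI (I.mul_mem_left a hx) _, grProj_mem _ _⟩
      · rw [Pi.single_eq_of_ne hj]
        exact ⟨zero_mem _, zero_mem _⟩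

/-- The Koszul complex of `x, y, z` is exact in the second place. -/
theorem exists_cross_eq_of_dotProduct_eq_zero {v : Fin 3 → MvPolynomial (Fin 3) k}
    (hv : X ⬝ᵥ v = 0) : ∃ u, X ⨯₃ u = v := by
  rw [vec3_dotProduct] at hv
  have h2 : v 2 ∈ Ideal.span (X '' ({0, 1} : Set (Fin 3)) : Set (MvPolynomial (Fin 3) k)) := by
    have h : X 2 * v 2 ∈
        Ideal.span (X '' ({0, 1} : Set (Fin 3)) : Set (MvPolynomial (Fin 3) k)) := by
      rw [show X 2 * v 2 = -v 0 * X 0 + -v 1 * X 1 by linear_combination hv]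
      exact add_mem (Ideal.mul_mem_left _ _ (Ideal.subset_span ⟨0, by simp, rfl⟩))
        (Ideal.mul_mem_left _ _ (Ideal.subset_span ⟨1, by simp, rfl⟩))
    rw [mem_ideal_span_X_image] at h ⊢
    intro m hm
    obtain ⟨i, hi, hmi⟩ := h (Finsupp.single 2 1 + m) (by
      rw [MvPolynomial.mem_support_iff, coeff_X_mul]
      exact MvPolynomial.mem_support_iff.1 hm)
    refine ⟨i, hi, ?_⟩
    have : i ≠ 2 := by rintro rfl; simp at hi
    simpa [Finsupp.single_apply, this.symm] using hmi
  rw [Set.image_pair, Ideal.mem_span_pair] at h2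
  obtain ⟨a, b, hab⟩ := h2
  have h1 : X 0 * (v 0 + X 2 * a) = -(X 1 * (v 1 + X 2 * b)) := by
    linear_combination hv + X 2 * hab
  have hdvd : (X 1 : MvPolynomial (Fin 3) k) ∣ v 0 + X 2 * a := by
    have : (X 1 : MvPolynomial (Fin 3) k) ∣ X 0 * (v 0 + X 2 * a) := by
      rw [h1, dvd_neg]
      exact dvd_mul_right _ _
    refine (X_prime.dvd_or_dvd this).resolve_left fun h => ?_
    rw [X_dvd_X] at h
    simp at h
  obtain ⟨c, hc⟩ := hdvd
  have hc' : v 1 + X 2 * b = -(X 0 * c) := by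
    apply mul_left_cancel₀ (X_ne_zero (R := k) (1 : Fin 3))
    rw [hc] at h1
    linear_combination h1
  refine ⟨![-b, a, c], ?_⟩
  rw [cross_apply]
  ext1 i
  fin_cases i
  · simp
    linear_combination -hc
  · simp
    linear_combination -hc'
  · simp
    linear_combination hab

theorem exists_mem_gr_cross_eq {v : Fin 3 → MvPolynomial (Fin 3) k} {t : ℤ}
    (hvt : ∀ i, v i ∈ gr k t) (hv : X ⬝ᵥ v = 0) :
    ∃ u, (∀ i, u i ∈ gr k (t - 1)) ∧ X ⨯₃ u = v := by
  obtain ⟨u, rfl⟩ := exists_cross_eq_of_dotProduct_eq_zero hv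
  refine ⟨fun i => grProj k (t - 1) (u i), fun i => grProj_mem _ _, ?_⟩
  ext1 i
  rw [← grProj_of_mem (hvt i)]
  simp only [cross_apply]
  fin_cases i <;> simp [grProj_X_mul]

instance (t : ℤ) : FiniteDimensional k (gr k t) := by
  rcases lt_or_ge t 0 with ht | ht
  · rw [gr_of_neg ht]
    infer_instance
  · lift t to ℕ using ht
    rw [← homogeneousSubmodule_eq_gr]
    exact Module.Finite.iff_fg.2 (homogeneousSubmodule_fg _ _ _)

theorem finrank_gr_natCast (n : ℕ) : finrank k (gr k n) = (n + 2).choose n := by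
  have hset : {m : Fin 3 →₀ ℕ | Finsupp.weight (fun _ : Fin 3 => (1 : ℤ)) m = n} =
      ((Finset.univ : Finset (Fin 3)).finsuppAntidiag n : Set (Fin 3 →₀ ℕ)) := by
    ext m
    simp only [weight_one_int, Finsupp.degree_eq_sum, Set.mem_ofPred_eq, Nat.cast_inj,
      SetLike.mem_coe, Finset.mem_finsuppAntidiag, Finset.subset_univ, and_true]
  have hgr : gr k n = restrictSupport k ((Finset.univ : Finset (Fin 3)).finsuppAntidiag n) := by
    rw [gr, weightedHomogeneousSubmodule_eq_finsupp_supported, hset]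
    rfl
  rw [hgr, Module.finrank_eq_nat_card_basis (basisRestrictSupport k _), Nat.card_coe_set_eq,
    Set.ncard_coe_finset, Finset.card_finsuppAntidiag_nat_eq_choose, Finset.card_univ,
    Fintype.card_fin, show 3 + n - 1 = n + 2 by omega]

theorem two_mul_finrank_gr {t : ℤ} (ht : -2 ≤ t) :
    2 * (finrank k (gr k t) : ℤ) = (t + 1) * (t + 2) := by
  rcases lt_or_ge t 0 with h0 | h0
  · rw [gr_of_neg h0, finrank_bot]
    obtain rfl | rfl : t = -1 ∨ t = -2 := by omega
    all_goals norm_num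
  · lift t to ℕ using h0
    rw [finrank_gr_natCast, Nat.choose_symm_add, Nat.choose_two_right,
      Nat.add_sub_assoc (by norm_num), mul_comm (t + 2)]
    have := Nat.div_mul_cancel (Nat.even_mul_pred_self (t + 2)).two_dvd
    rw [Nat.add_sub_assoc (by norm_num), mul_comm (t + 2)] at this
    rw [mul_comm]
    exact_mod_cast this

end Polynomial

section Quotient

open Matrix Module

variable {k : Type*} [Field k] (I : Ideal (MvPolynomial (Fin 3) k))

/-- The component of degree `t` of `k[x,y,z]/I`. -/
noncomputable def grQuot (t : ℤ) : Submodule k (MvPolynomial (Fin 3) k ⧸ I) :=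
  (gr k t).map (Ideal.Quotient.mkₐ k I).toLinearMap

/-- The vectors with three entries in the component of degree `t` of `k[x,y,z]/I`. -/
noncomputable def grQuotVec (t : ℤ) : Submodule k (Fin 3 → MvPolynomial (Fin 3) k ⧸ I) :=
  Submodule.pi Set.univ fun _ => grQuot I t

/-- The vector of the classes of the variables in `k[x,y,z]/I`. -/
noncomputable def varQuot : Fin 3 → MvPolynomial (Fin 3) k ⧸ I :=
  fun i => Ideal.Quotient.mk I (X i)

/-- The last differential of the Koszul complex of `k[x,y,z]/I`. -/
noncomputable def koszulDot :
    (Fin 3 → MvPolynomial (Fin 3) k ⧸ I) →ₗ[k] MvPolynomial (Fin 3) k ⧸ I :=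
  dotProductBilin k k (varQuot I)

/-- The middle differential of the Koszul complex of `k[x,y,z]/I`. -/
noncomputable def koszulCross :
    (Fin 3 → MvPolynomial (Fin 3) k ⧸ I) →ₗ[k] Fin 3 → MvPolynomial (Fin 3) k ⧸ I :=
  (crossProduct (varQuot I)).restrictScalars k

variable {I}

theorem mem_grQuot {t : ℤ} {a : MvPolynomial (Fin 3) k ⧸ I} :
    a ∈ grQuot I t ↔ ∃ p ∈ gr k t, Ideal.Quotient.mk I p = a :=
  Iff.rfl

theorem mem_grQuotVec {t : ℤ} {v : Fin 3 → MvPolynomial (Fin 3) k ⧸ I} :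
    v ∈ grQuotVec I t ↔ ∀ i, v i ∈ grQuot I t := by
  simp [grQuotVec, Submodule.mem_pi]

theorem exists_lift_of_mem_grQuotVec {t : ℤ} {v : Fin 3 → MvPolynomial (Fin 3) k ⧸ I}
    (hv : v ∈ grQuotVec I t) :
    ∃ f : Fin 3 → MvPolynomial (Fin 3) k, (∀ i, f i ∈ gr k t) ∧
      v = fun i => Ideal.Quotient.mk I (f i) := by
  choose f hf hfv using fun i => mem_grQuot.1 (mem_grQuotVec.1 hv i)
  exact ⟨f, hf, funext fun i => (hfv i).symm⟩

theorem koszulDot_mk (f : Fin 3 → MvPolynomial (Fin 3) k) :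
    koszulDot I (fun i => Ideal.Quotient.mk I (f i)) = Ideal.Quotient.mk I (X ⬝ᵥ f) := by
  simp [koszulDot, varQuot, dotProduct]

theorem koszulCross_mk (f : Fin 3 → MvPolynomial (Fin 3) k) :
    koszulCross I (fun i => Ideal.Quotient.mk I (f i)) =
      fun i => Ideal.Quotient.mk I ((X ⨯₃ f) i) := by
  change varQuot I ⨯₃ _ = _
  ext1 i
  simp only [cross_apply, varQuot]
  fin_cases i <;> simp

theorem mul_mem_grQuot {s t : ℤ} {a b : MvPolynomial (Fin 3) k ⧸ I} (ha : a ∈ grQuot I s)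
    (hb : b ∈ grQuot I t) : a * b ∈ grQuot I (s + t) := by
  obtain ⟨p, hp, rfl⟩ := mem_grQuot.1 ha
  obtain ⟨q, hq, rfl⟩ := mem_grQuot.1 hb
  exact mem_grQuot.2 ⟨p * q, mul_mem_gr hp hq, map_mul _ _ _⟩

theorem varQuot_mem (i : Fin 3) : varQuot I i ∈ grQuot I 1 :=
  mem_grQuot.2 ⟨X i, X_mem_gr i, rfl⟩

theorem koszulCross_mem {t : ℤ} {u : Fin 3 → MvPolynomial (Fin 3) k ⧸ I}
    (hu : u ∈ grQuotVec I (t - 1)) : koszulCross I u ∈ grQuotVec I t := by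
  have h : ∀ i j, varQuot I i * u j ∈ grQuot I t := fun i j => by
    simpa using mul_mem_grQuot (varQuot_mem i) (mem_grQuotVec.1 hu j)
  rw [mem_grQuotVec]
  intro i
  change (varQuot I ⨯₃ u) i ∈ _
  simp only [cross_apply]
  fin_cases i <;> exact sub_mem (h _ _) (h _ _)

instance (t : ℤ) : FiniteDimensional k (grQuot I t) :=
  inferInstanceAs (FiniteDimensional k ((gr k t).map (Ideal.Quotient.mkₐ k I).toLinearMap))

theorem finrank_gr_eq_add (t : ℤ) :
    finrank k (gr k t) =
      finrank k (grQuot I t) + finrank k (I.restrictScalars k ⊓ gr k t : Submodule k _) := by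
  rw [← Submodule.finrank_map_add_finrank_ker_inf (Ideal.Quotient.mkₐ k I).toLinearMap]
  have h : LinearMap.ker (Ideal.Quotient.mkₐ k I).toLinearMap = I.restrictScalars k := by
    ext p
    simp [Ideal.Quotient.eq_zero_iff_mem]
  rw [h]
  rfl

/-- The whole ring is generated in degree `0`. -/
theorem exists_eq_sum_X_mul_of_ne_zero {t : ℤ} (ht : t ≠ 0) {p : MvPolynomial (Fin 3) k}
    (hp : p ∈ gr k t) :
    ∃ g : Fin 3 → MvPolynomial (Fin 3) k, (∀ i, g i ∈ gr k (t - 1)) ∧ X ⬝ᵥ g = p := by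
  have hS : ({1} : Set (MvPolynomial (Fin 3) k)) ⊆ gr k 0 := by
    rw [Set.singleton_subset_iff]
    exact isWeightedHomogeneous_one k _
  obtain ⟨g, hg, h⟩ := exists_eq_sum_X_mul hS Ideal.span_singleton_one.symm ht
    (Submodule.mem_top (x := p)) hp
  exact ⟨g, fun i => (hg i).2, h⟩

theorem map_koszulDot {t : ℤ} (ht : t ≠ 0) :
    (grQuotVec I (t - 1)).map (koszulDot I) = grQuot I t := by
  apply le_antisymm
  · rintro _ ⟨v, hv, rfl⟩
    obtain ⟨f, hf, rfl⟩ := exists_lift_of_mem_grQuotVec hv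
    rw [koszulDot_mk]
    exact mem_grQuot.2 ⟨_, sum_mem fun i _ => X_mul_mem_gr i (hf i), rfl⟩
  · intro a ha
    obtain ⟨p, hp, rfl⟩ := mem_grQuot.1 ha
    obtain ⟨g, hg, rfl⟩ := exists_eq_sum_X_mul_of_ne_zero ht hp
    refine ⟨fun i => Ideal.Quotient.mk I (g i), ?_, koszulDot_mk g⟩
    exact mem_grQuotVec.2 fun i => mem_grQuot.2 ⟨_, hg i, rfl⟩

theorem ker_koszulDot_inf {d : ℤ} {S : Set (MvPolynomial (Fin 3) k)} (hS : S ⊆ gr k d)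
    (hI : I = Ideal.span S) {t : ℤ} (ht : t ≠ d) :
    LinearMap.ker (koszulDot I) ⊓ grQuotVec I (t - 1) =
      (grQuotVec I (t - 2)).map (koszulCross I) := by
  apply le_antisymm
  · rintro v ⟨hv0, hv⟩
    obtain ⟨f, hf, rfl⟩ := exists_lift_of_mem_grQuotVec hv
    rw [SetLike.mem_coe, LinearMap.mem_ker, koszulDot_mk, Ideal.Quotient.eq_zero_iff_mem] at hv0
    obtain ⟨g, hg, hgf⟩ := exists_eq_sum_X_mul hS hI ht hv0
      (sum_mem fun i _ => X_mul_mem_gr i (hf i))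
    obtain ⟨u, hu, huv⟩ := exists_mem_gr_cross_eq (v := f - g) (t := t - 1)
      (fun i => sub_mem (hf i) (hg i).2) (by rw [dotProduct_sub, hgf, sub_self])
    refine ⟨fun i => Ideal.Quotient.mk I (u i), ?_, ?_⟩
    · rw [show t - 1 - 1 = t - 2 by ring] at hu
      exact mem_grQuotVec.2 fun i => mem_grQuot.2 ⟨_, hu i, rfl⟩
    · rw [koszulCross_mk, huv]
      ext1 i
      rw [Ideal.Quotient.mk_eq_mk_iff_sub_mem]
      simpa using (hg i).1
  · rintro _ ⟨u, hu, rfl⟩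
    refine ⟨?_, koszulCross_mem (by rwa [show t - 1 - 1 = t - 2 by ring])⟩
    exact dot_self_cross (varQuot I) u

instance (t : ℤ) : FiniteDimensional k (grQuotVec I t) :=
  Submodule.finiteDimensional_pi_const _ _

theorem finrank_koszul {d : ℤ} {S : Set (MvPolynomial (Fin 3) k)} (hS : S ⊆ gr k d)
    (hI : I = Ideal.span S) {t : ℤ} (ht0 : t ≠ 0) (ht : t ≠ d) :
    finrank k (grQuot I t) + finrank k ((grQuotVec I (t - 2)).map (koszulCross I)) =
      3 * finrank k (grQuot I (t - 1)) := by
  rw [← map_koszulDot ht0, ← ker_koszulDot_inf hS hI ht,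
    Submodule.finrank_map_add_finrank_ker_inf]
  exact Submodule.finrank_pi_const _ _

end Quotient

section Duality

open Matrix Module

variable {k : Type*} [Field k] {I : Ideal (MvPolynomial (Fin 3) k)}

theorem gr_le_mIdeal_pow (n : ℕ) {p : MvPolynomial (Fin 3) k} (hp : p ∈ gr k n) :
    p ∈ mIdeal k ^ n := by
  induction n generalizing p with
  | zero => simp
  | succ n ih =>
    obtain ⟨g, hg, rfl⟩ := exists_eq_sum_X_mul_of_ne_zero (by positivity) hp
    rw [pow_succ']
    refine sum_mem fun i _ => Ideal.mul_mem_mul (Ideal.subset_span ⟨i, rfl⟩) (ih ?_)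
    simpa using hg i

/-- The quotient by a proper ideal containing a power of `𝔪` has a socle degree. -/
theorem exists_socle_degree (hproper : I ≠ ⊤) (hprim : ∃ N : ℕ, mIdeal k ^ N ≤ I) :
    ∃ s : ℕ, (∃ p ∈ gr k s, p ∉ I) ∧ ∀ t : ℤ, s < t → ∀ p ∈ gr k t, p ∈ I := by
  classical
  have hex : ∃ N : ℕ, ∀ n : ℕ, N ≤ n → ∀ p ∈ gr k (n : ℤ), p ∈ I := by
    obtain ⟨N, hN⟩ := hprim
    exact ⟨N, fun n hn p hp => hN (Ideal.pow_le_pow_right hn (gr_le_mIdeal_pow n hp))⟩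
  have hspec := Nat.find_spec hex
  have hmin : ∀ m < Nat.find hex, ¬ _ := fun m hm => Nat.find_min hex hm
  generalize Nat.find hex = N at hspec hmin
  obtain _ | s := N
  · refine absurd ((Ideal.eq_top_iff_one I).2 (hspec 0 le_rfl 1 ?_)) hproper
    exact isWeightedHomogeneous_one k _
  · refine ⟨s, ?_, fun t ht => ?_⟩
    · by_contra! h
      refine hmin s (Nat.lt_succ_self s) fun n hn => ?_
      rcases hn.eq_or_lt with rfl | hn
      · exact h
      · exact hspec n hn
    · lift t to ℕ using by omega
      exact hspec t (by omega)

/-- If the socle is one-dimensional, any nonzero element of the socle spans it. -/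
theorem exists_smul_eq_of_mem_socle (hsoc : socDim I = 1) {a b : MvPolynomial (Fin 3) k ⧸ I}
    (ha0 : a ≠ 0) (ha : ∀ i, varQuot I i * a = 0) (hb : ∀ i, varQuot I i * b = 0) :
    ∃ c : k, c • a = b := by
  have hmem : ∀ a : MvPolynomial (Fin 3) k ⧸ I, (∀ i, varQuot I i * a = 0) →
      a ∈ Submodule.map (Ideal.Quotient.mkₐ k I).toLinearMap
        ((Submodule.colon I (mIdeal k)).restrictScalars k) := by
    intro a ha
    obtain ⟨p, rfl⟩ := Ideal.Quotient.mk_surjective a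
    refine ⟨p, ?_, rfl⟩
    rw [SetLike.mem_coe, Submodule.restrictScalars_mem, Submodule.mem_colon]
    intro q hq
    induction hq using Submodule.span_induction with
    | mem x hx =>
      obtain ⟨i, rfl⟩ := hx
      rw [smul_eq_mul, mul_comm, ← Ideal.Quotient.eq_zero_iff_mem, map_mul]
      exact ha i
    | zero => simp
    | add x y _ _ hx hy => rw [smul_add]; exact add_mem hx hy
    | smul c x _ hx => rw [smul_comm]; exact I.smul_mem c hx
  have h := (finrank_eq_one_iff_of_nonzero'
    (⟨a, hmem a ha⟩ : Submodule.map (Ideal.Quotient.mkₐ k I).toLinearMap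
        ((Submodule.colon I (mIdeal k)).restrictScalars k)) (by simpa using ha0)).1 hsoc
  obtain ⟨c, hc⟩ := h ⟨b, hmem b hb⟩
  exact ⟨c, congrArg Subtype.val hc⟩

theorem grQuot_eq_bot {t : ℤ} (h : ∀ p ∈ gr k t, p ∈ I) : grQuot I t = ⊥ := by
  rw [eq_bot_iff]
  intro a ha
  obtain ⟨p, hp, rfl⟩ := mem_grQuot.1 ha
  exact Ideal.Quotient.eq_zero_iff_mem.2 (h p hp)

/-- Distinct graded pieces of the quotient by a homogeneous ideal are independent. -/
theorem disjoint_grQuot {d : ℤ} {S : Set (MvPolynomial (Fin 3) k)} (hS : S ⊆ gr k d)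
    (hI : I = Ideal.span S) {s t : ℤ} (hst : s ≠ t) : Disjoint (grQuot I s) (grQuot I t) := by
  rw [Submodule.disjoint_def]
  intro a hs ht
  obtain ⟨p, hp, rfl⟩ := mem_grQuot.1 hs
  obtain ⟨q, hq, hqp⟩ := mem_grQuot.1 ht
  rw [Ideal.Quotient.mk_eq_mk_iff_sub_mem] at hqp
  have := grProj_mem_of_mem hS hI hqp s
  rw [map_sub, grProj_of_mem_ne hq hst, grProj_of_mem hp, zero_sub, neg_mem_iff] at this
  exact Ideal.Quotient.eq_zero_iff_mem.2 this

/-- Multiplication to the socle is a perfect pairing on a graded Artinian Gorenstein quotient. -/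
theorem exists_perfect_functional {d : ℤ} {S : Set (MvPolynomial (Fin 3) k)} (hS : S ⊆ gr k d)
    (hI : I = Ideal.span S) (hsoc : socDim I = 1) {s : ℤ} (hs : ∃ p ∈ gr k s, p ∉ I)
    (hs' : ∀ t, s < t → ∀ p ∈ gr k t, p ∈ I) :
    ∃ φ : (MvPolynomial (Fin 3) k ⧸ I) →ₗ[k] k, ∀ t, ∀ a ∈ grQuot I t, a ≠ 0 →
      ∃ b ∈ grQuot I (s - t), φ (a * b) ≠ 0 := by
  obtain ⟨p, hp, hpI⟩ := hs
  have hmul : ∀ (t : ℤ) (i : Fin 3), ∀ a ∈ grQuot I t, varQuot I i * a ∈ grQuot I (t + 1) :=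
    fun t i a ha => by rw [add_comm]; exact mul_mem_grQuot (varQuot_mem i) ha
  have htop : ∀ a ∈ grQuot I s, ∀ i, varQuot I i * a = 0 := fun a ha i => by
    have := hmul s i a ha
    rwa [grQuot_eq_bot (hs' (s + 1) (by omega))] at this
  set a₀ := Ideal.Quotient.mk I p
  have ha₀ : a₀ ∈ grQuot I s := mem_grQuot.2 ⟨p, hp, rfl⟩
  have h0 : a₀ ≠ 0 := fun h => hpI (Ideal.Quotient.eq_zero_iff_mem.1 h)
  obtain ⟨φ, hφ⟩ := Projective.exists_dual_eq_one k h0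
  refine ⟨φ, fun t a ha hane => ?_⟩
  suffices key : ∀ n : ℕ, ∀ t, s - t = n → ∀ a ∈ grQuot I t, a ≠ 0 →
      ∃ b ∈ grQuot I (s - t), a * b ∈ grQuot I s ∧ a * b ≠ 0 by
    have hts : t ≤ s := by
      by_contra! h
      rw [grQuot_eq_bot (hs' t h)] at ha
      exact hane ha
    obtain ⟨b, hb, habs, hab⟩ := key (s - t).toNat t (by omega) a ha hane
    refine ⟨b, hb, ?_⟩
    obtain ⟨c, hc⟩ := exists_smul_eq_of_mem_socle hsoc h0 (htop _ ha₀) (htop _ habs)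
    rw [← hc, map_smul, hφ, smul_eq_mul, mul_one]
    rintro rfl
    exact hab (by rw [← hc, zero_smul])
  intro n
  induction n with
  | zero =>
    intro t ht a ha hane
    obtain rfl : s = t := by simpa [sub_eq_zero] using ht
    refine ⟨1, mem_grQuot.2 ⟨1, ?_, map_one _⟩, by rwa [mul_one], by rwa [mul_one]⟩
    rw [sub_self]
    exact isWeightedHomogeneous_one k _
  | succ n ih =>
    intro t ht a ha hane
    obtain ⟨i, hi⟩ : ∃ i, varQuot I i * a ≠ 0 := by
      by_contra! h
      obtain ⟨c, hc⟩ := exists_smul_eq_of_mem_socle hsoc h0 (htop _ ha₀) h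
      refine hane ((Submodule.disjoint_def.1 (disjoint_grQuot hS hI (by omega : s ≠ t))) a ?_ ha)
      rw [← hc]
      exact Submodule.smul_mem _ c ha₀
    obtain ⟨b, hb, h1, h2⟩ := ih (t + 1) (by push_cast at ht; omega) _ (hmul t i a ha) hi
    have e : a * (varQuot I i * b) = varQuot I i * a * b := by ring
    refine ⟨varQuot I i * b, ?_, by rwa [e], by rwa [e]⟩
    have := hmul _ i b hb
    rwa [show s - (t + 1) + 1 = s - t by ring] at this

variable {s : ℤ} {φ : (MvPolynomial (Fin 3) k ⧸ I) →ₗ[k] k}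

theorem finrank_grQuot_symm (hφ : ∀ t, ∀ a ∈ grQuot I t, a ≠ 0 →
      ∃ b ∈ grQuot I (s - t), φ (a * b) ≠ 0) (t : ℤ) :
    finrank k (grQuot I (s - t)) = finrank k (grQuot I t) := by
  set B := (LinearMap.mul k (MvPolynomial (Fin 3) k ⧸ I)).compr₂ φ
  have h : ∀ t, finrank k (LinearMap.range
      ((B ∘ₗ LinearMap.id).domRestrict₁₂ (grQuot I t) (grQuot I (s - t)))) =
        finrank k (grQuot I t) := fun t => by
    rw [finrank_range_domRestrict_comp, Submodule.map_id]
    exact hφ t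
  rw [← h t, ← h (s - t), ← finrank_range_flip, sub_sub_cancel]
  exact congrArg (fun f => finrank k (LinearMap.range f))
    (LinearMap.ext₂ fun a b => congrArg φ (mul_comm b.1 a.1))

variable (φ) in
/-- The trilinear determinant form with first argument the vector of variables. -/
noncomputable def crossForm : (Fin 3 → MvPolynomial (Fin 3) k ⧸ I) →ₗ[k]
    (Fin 3 → MvPolynomial (Fin 3) k ⧸ I) →ₗ[k] k :=
  (dotProductBilin k k).compr₂ φ ∘ₗ koszulCross I

theorem crossForm_apply (u v : Fin 3 → MvPolynomial (Fin 3) k ⧸ I) :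
    crossForm φ u v = φ (varQuot I ⨯₃ u ⬝ᵥ v) :=
  rfl

theorem isAlt_crossForm : (crossForm φ).IsAlt := fun u => by
  rw [crossForm_apply, dotProduct_comm, dot_cross_self, map_zero]

theorem finrank_range_crossForm (hφ : ∀ t, ∀ a ∈ grQuot I t, a ≠ 0 →
      ∃ b ∈ grQuot I (s - t), φ (a * b) ≠ 0) {i j : ℤ} (hij : i + j = s - 1) :
    finrank k (LinearMap.range
      ((crossForm φ).domRestrict₁₂ (grQuotVec I i) (grQuotVec I j))) =
    finrank k ((grQuotVec I i).map (koszulCross I)) := by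
  refine finrank_range_domRestrict_comp _ _ _ _ fun u hu hne => ?_
  obtain ⟨l, hl⟩ := Function.ne_iff.1 hne
  have hmem := mem_grQuotVec.1 (koszulCross_mem (t := i + 1) (by rwa [add_sub_cancel_right])) l
  obtain ⟨b, hb, hab⟩ := hφ _ _ hmem hl
  rw [show s - (i + 1) = j by omega] at hb
  refine ⟨Pi.single l b, mem_grQuotVec.2 fun m => ?_, ?_⟩
  · rcases eq_or_ne m l with rfl | h
    · rwa [Pi.single_eq_same]
    · rw [Pi.single_eq_of_ne h]
      exact zero_mem _
  · simpa using hab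

theorem finrank_map_koszulCross_symm (hφ : ∀ t, ∀ a ∈ grQuot I t, a ≠ 0 →
      ∃ b ∈ grQuot I (s - t), φ (a * b) ≠ 0) {i j : ℤ} (hij : i + j = s - 1) :
    finrank k ((grQuotVec I i).map (koszulCross I)) =
      finrank k ((grQuotVec I j).map (koszulCross I)) := by
  rw [← finrank_range_crossForm hφ hij, ← finrank_range_crossForm hφ ((add_comm j i).trans hij),
    ← finrank_range_flip, ← LinearMap.range_neg]
  exact congrArg (fun f => finrank k (LinearMap.range f))
    (LinearMap.ext₂ fun u v => isAlt_crossForm.neg v.1 u.1)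

theorem even_finrank_map_koszulCross (hφ : ∀ t, ∀ a ∈ grQuot I t, a ≠ 0 →
      ∃ b ∈ grQuot I (s - t), φ (a * b) ≠ 0) {i : ℤ} (hi : i + i = s - 1) :
    Even (finrank k ((grQuotVec I i).map (koszulCross I))) := by
  rw [← finrank_range_crossForm hφ hi]
  exact LinearMap.IsAlt.even_finrank_range fun u => isAlt_crossForm u.1

end Duality

section Gorenstein

open Module

variable {k : Type*} [Field k] {I : Ideal (MvPolynomial (Fin 3) k)}

theorem eq_zero_of_mem_of_lt {d : ℤ} {S : Set (MvPolynomial (Fin 3) k)} (hS : S ⊆ gr k d)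
    (hI : I = Ideal.span S) {t : ℤ} (ht : t < d) {p : MvPolynomial (Fin 3) k} (hp : p ∈ I)
    (hpt : p ∈ gr k t) : p = 0 := by
  obtain ⟨n, hn⟩ : ∃ n : ℕ, t < n := ⟨t.toNat + 1, by omega⟩
  induction n generalizing t p with
  | zero => rwa [gr_of_neg (by simpa using hn), Submodule.mem_bot] at hpt
  | succ n ih =>
    obtain ⟨g, hg, rfl⟩ := exists_eq_sum_X_mul hS hI ht.ne hp hpt
    push_cast at hn
    have hg0 : g = 0 :=
      funext fun i => ih (by omega : t - 1 < d) (hg i).1 (hg i).2 (by omega)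
    simp [hg0]

theorem finrank_grQuot_of_lt {d : ℤ} {S : Set (MvPolynomial (Fin 3) k)} (hS : S ⊆ gr k d)
    (hI : I = Ideal.span S) {t : ℤ} (ht : t < d) :
    finrank k (grQuot I t) = finrank k (gr k t) := by
  have h : (I.restrictScalars k ⊓ gr k t : Submodule k _) = ⊥ :=
    (Submodule.eq_bot_iff _).2 fun p hp => eq_zero_of_mem_of_lt hS hI ht hp.1 hp.2
  rw [finrank_gr_eq_add (I := I) t, h, finrank_bot, add_zero]

/-- The numerical relation between generator degree, number of generators and socle degree `s`
of a Gorenstein ideal generated in a single degree. -/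
theorem socleDegree_relation {d : ℕ} (hd : 1 ≤ d)
    (hgen : I = Ideal.span ((I.restrictScalars k ⊓ gr k d : Submodule k _) : Set _))
    (hsoc : socDim I = 1) {s : ℕ} (hs : ∃ p ∈ gr k s, p ∉ I)
    (hs' : ∀ t : ℤ, s < t → ∀ p ∈ gr k t, p ∈ I) {r : ℕ}
    (hr : r = finrank k (I.restrictScalars k ⊓ gr k d : Submodule k _)) :
    0 < r ∧ ((r : ℤ) - 1) * (s + 3) = 2 * r * d ∧ Odd r := by
  have hS : ((I.restrictScalars k ⊓ gr k d : Submodule k _) : Set (MvPolynomial (Fin 3) k)) ⊆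
      gr k d := fun _ hp => hp.2
  obtain ⟨φ, hφ⟩ := exists_perfect_functional hS hgen hsoc hs hs'
  have hXgr : (X 0 ^ (s + 1) : MvPolynomial (Fin 3) k) ∈ gr k (s + 1 : ℕ) :=
    mem_gr_natCast.2 (isHomogeneous_X_pow 0 (s + 1))
  have hXI : (X 0 ^ (s + 1) : MvPolynomial (Fin 3) k) ∈ I := hs' _ (by push_cast; omega) _ hXgr
  have hX0 : (X 0 ^ (s + 1) : MvPolynomial (Fin 3) k) ≠ 0 := pow_ne_zero _ (X_ne_zero 0)
  have hds : (d : ℤ) ≤ s + 1 := by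
    by_contra! h
    exact hX0 (eq_zero_of_mem_of_lt hS hgen (by push_cast; omega) hXI hXgr)
  have hr0 : 0 < r := by
    rw [hr, Nat.pos_iff_ne_zero]
    intro h
    rw [Submodule.finrank_eq_zero.1 h] at hgen
    rw [hgen] at hXI
    simp at hXI
  have hsym := finrank_grQuot_symm hφ
  have hlow : ∀ t : ℤ, -2 ≤ t → t < d → 2 * (finrank k (grQuot I t) : ℤ) = (t + 1) * (t + 2) :=
    fun t h1 h2 => by rw [finrank_grQuot_of_lt hS hgen h2, two_mul_finrank_gr h1]
  have hcross := fun {i j : ℤ} => finrank_map_koszulCross_symm (i := i) (j := j) hφ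
  have := numerical_consequences (h := fun t => (finrank k (grQuot I t) : ℤ)) (s := s) (d := d)
    (r := r) (fun t ht => ?_) (fun t => ?_) ?_ (fun j h0 h1 h2 h3 => ?_) (by omega) hds
    (by omega) ?_ (fun j h0 h1 h2 => ?_)
  · exact ⟨hr0, this.1, by exact_mod_cast this.2⟩
  · have := finrank_grQuot_of_lt hS hgen (t := t) (by omega)
    rw [gr_of_neg ht, finrank_bot] at this
    exact_mod_cast this
  · exact_mod_cast hsym t
  · have := hlow 0 (by norm_num) (by omega)
    omega
  · have e1 := finrank_koszul hS hgen h0 h1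
    have e2 := finrank_koszul hS hgen (t := s + 3 - j) (by omega) (by omega)
    have e3 := hcross (i := j - 2) (j := s + 3 - j - 2) (by ring)
    have e4 := hsym (j - 2)
    have e5 := hsym (j - 3)
    rw [show (s : ℤ) - (j - 2) = s + 3 - j - 1 by ring] at e4
    rw [show (s : ℤ) - (j - 3) = s + 3 - j by ring] at e5
    omega
  · have e0 := finrank_gr_eq_add (I := I) (d : ℤ)
    rw [← hr] at e0
    have e1 := two_mul_finrank_gr (k := k) (t := d) (by omega)
    have e2 := hlow (d - 1) (by omega) (by omega)
    have e3 := hlow (d - 2) (by omega) (by omega)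
    have e4 := hlow (d - 3) (by omega) (by omega)
    rw [e0] at e1
    push_cast at e1
    linarith
  · have e1 := finrank_koszul hS hgen h0 h1
    obtain ⟨c, hc⟩ := even_finrank_map_koszulCross hφ (i := j - 2) (by omega)
    refine ⟨c, ?_⟩
    omega

end Gorenstein

/-- If `I ⊆ k[x,y,z]` is a proper homogeneous `𝔪`-primary Gorenstein ideal
(1-dimensional socle) generated by its degree-`d` component, and `r = dim_k I_d`, then
`r ≥ 3` is odd, `r−1` divides `2d`, and the socle degree of `R/I` equals
`2d + d' − 3` with `d' = 2d/(r−1)`. -/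
theorem stmt7 {k : Type*} [Field k] (d : ℕ) (hd : 1 ≤ d)
    (I : Ideal (MvPolynomial (Fin 3) k))
    (hproper : I ≠ ⊤)
    (hprim : ∃ N : ℕ, 1 ≤ N ∧ (mIdeal k) ^ N ≤ I)
    (hgen : I = Ideal.span
      ((I.restrictScalars k ⊓ homogeneousSubmodule (Fin 3) k d : Submodule k _) : Set _))
    (hsoc : socDim I = 1)
    (r : ℕ)
    (hr : r = Module.finrank k ↥(I.restrictScalars k ⊓ homogeneousSubmodule (Fin 3) k d)) :
    3 ≤ r ∧ Odd r ∧ (r - 1) ∣ 2 * d ∧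
      IsGreatest {t : ℕ | ∃ h : MvPolynomial (Fin 3) k, h.IsHomogeneous t ∧ h ∉ I}
        (2 * d + 2 * d / (r - 1) - 3) := by
  rw [homogeneousSubmodule_eq_gr] at hgen hr
  obtain ⟨N, -, hN⟩ := hprim
  obtain ⟨s, hs, hs'⟩ := exists_socle_degree hproper ⟨N, hN⟩
  obtain ⟨hr0, hrel, hodd⟩ := socleDegree_relation hd hgen hsoc hs hs' hr
  obtain ⟨m, rfl⟩ := hodd
  have hrel' : 2 * m * (s + 3) = 2 * (2 * m + 1) * d := by
    push_cast at hrel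
    zify
    linarith
  have hm : 0 < m := by
    rw [Nat.pos_iff_ne_zero]
    rintro rfl
    omega
  have hdvd : 2 * m ∣ 2 * d := by
    refine (Nat.Coprime.dvd_of_dvd_mul_left (?_ : Nat.Coprime (2 * m) (2 * m + 1)) ?_)
    · simp
    · exact ⟨s + 3, by linarith⟩
  rw [Nat.add_sub_cancel]
  refine ⟨by omega, odd_two_mul_add_one m, hdvd, ?_⟩
  obtain ⟨c, hc⟩ := hdvd
  have hsc : s + 3 = 2 * d + c :=
    Nat.eq_of_mul_eq_mul_left (by omega : 0 < 2 * m) (by rw [hrel']; linear_combination hc)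
  rw [hc, Nat.mul_div_cancel_left _ (by omega), ← hc, ← hsc, Nat.add_sub_cancel]
  obtain ⟨p, hp, hpI⟩ := hs
  refine ⟨⟨p, mem_gr_natCast.1 hp, hpI⟩, fun t ⟨q, hq, hqI⟩ => ?_⟩
  by_contra! h
  exact hqI (hs' t (by exact_mod_cast h) q (mem_gr_natCast.2 hq))
end

section
/- Let k be a field and let d ≥ 2 and r ≥ 3 be integers with r odd and (r−1)/2 dividing d. Then there exists a proper homogeneous 𝔪-primary ideal I ⊆ R = k[x,y,z] which is generated by its degree-d homogeneous component, with dim_k I_d = r and dim_k Soc(R/I) = 1. (This is the case n = 3 of the statement that every equigenerated Gorenstein virtual datum (d,r) is proper, valid in arbitrary characteristic: there exists a codimension-3 Gorenstein ideal minimally generated by r forms of degree d.) -/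
open MvPolynomial

namespace GorensteinChebyshev

variable {k : Type*} [Field k]

/-- The exponent vector `(a, b, n)`. -/
noncomputable def expo (a b n : ℕ) : Fin 3 →₀ ℕ :=
  Finsupp.single 0 a + Finsupp.single 1 b + Finsupp.single 2 n

@[simp] lemma expo_zero (a b n : ℕ) : expo a b n 0 = a := by simp [expo]
@[simp] lemma expo_one (a b n : ℕ) : expo a b n 1 = b := by simp [expo]
@[simp] lemma expo_two (a b n : ℕ) : expo a b n 2 = n := by simp [expo]

lemma expo_self (v : Fin 3 →₀ ℕ) : expo (v 0) (v 1) (v 2) = v := by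
  ext i; fin_cases i <;> simp

lemma expo_inj {a b n a' b' n' : ℕ} :
    expo a b n = expo a' b' n' ↔ a = a' ∧ b = b' ∧ n = n' := by
  refine ⟨fun h => ?_, by rintro ⟨rfl, rfl, rfl⟩; rfl⟩
  have h0 := DFunLike.congr_fun h 0
  have h1 := DFunLike.congr_fun h 1
  have h2 := DFunLike.congr_fun h 2
  simp at h0 h1 h2
  exact ⟨h0, h1, h2⟩

/-- The monomial `x ^ a * y ^ b * z ^ n`. -/
noncomputable def mon (k : Type*) [Field k] (a b n : ℕ) : MvPolynomial (Fin 3) k :=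
  X 0 ^ a * X 1 ^ b * X 2 ^ n

lemma mon_eq_monomial (a b n : ℕ) : mon k a b n = monomial (expo a b n) 1 := by
  simp [mon, expo, X_pow_eq_monomial, monomial_mul]

lemma coeff_mon (a b n a' b' n' : ℕ) :
    coeff (expo a b n) (mon k a' b' n') = if a' = a ∧ b' = b ∧ n' = n then 1 else 0 := by
  classical
  rw [mon_eq_monomial, coeff_monomial]
  simp only [expo_inj]

lemma linearMap_ext {M : Type*} [AddCommMonoid M] [Module k M]
    {f g : MvPolynomial (Fin 3) k →ₗ[k] M}
    (h : ∀ a b n, f (mon k a b n) = g (mon k a b n)) : f = g := by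
  refine (basisMonomials (Fin 3) k).ext fun v => ?_
  have := h (v 0) (v 1) (v 2)
  rwa [mon_eq_monomial, expo_self] at this

/-- The linear endomorphism of `k[x,y,z]` with prescribed values on monomials. -/
noncomputable def lin (F : ℕ → ℕ → ℕ → MvPolynomial (Fin 3) k) :
    MvPolynomial (Fin 3) k →ₗ[k] MvPolynomial (Fin 3) k :=
  (basisMonomials (Fin 3) k).constr k fun v => F (v 0) (v 1) (v 2)

lemma lin_mon (F : ℕ → ℕ → ℕ → MvPolynomial (Fin 3) k) (a b n : ℕ) :
    lin F (mon k a b n) = F a b n := by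
  have := (basisMonomials (Fin 3) k).constr_basis k
    (fun v : Fin 3 →₀ ℕ => F (v 0) (v 1) (v 2)) (expo a b n)
  simpa [lin, mon_eq_monomial] using this

/-- Homogenised Chebyshev polynomials `q_j` in `z ^ e` and `(x y) ^ e`. -/
noncomputable def cheb (k : Type*) [Field k] (e : ℕ) : ℕ → MvPolynomial (Fin 3) k
  | 0 => 1
  | 1 => X 2 ^ e
  | j + 2 => X 2 ^ e * cheb k e (j + 1) - X 0 ^ e * X 1 ^ e * cheb k e j

/-- The operator expressing multiplication by `z` in the basis
`x ^ a * y ^ b * q_i * z ^ t`, `t < e`, where this element is indexed by `(a, b, e * i + t)`. -/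
noncomputable def mulZ (k : Type*) [Field k] (e : ℕ) :
    MvPolynomial (Fin 3) k →ₗ[k] MvPolynomial (Fin 3) k :=
  lin fun a b n => mon k a b (n + 1) +
    if e ∣ n + 1 ∧ 2 * e ≤ n + 1 then mon k (a + e) (b + e) (n + 1 - 2 * e) else 0

/-- Coordinates of a polynomial in the basis `x ^ a * y ^ b * q_i * z ^ t`. -/
noncomputable def coords (k : Type*) [Field k] (e : ℕ) :
    MvPolynomial (Fin 3) k →ₗ[k] MvPolynomial (Fin 3) k :=
  lin fun a b n => X 0 ^ a * X 1 ^ b * ((mulZ k e) ^ n) 1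

/-- The inverse of `coords`. -/
noncomputable def ofCoords (k : Type*) [Field k] (e : ℕ) :
    MvPolynomial (Fin 3) k →ₗ[k] MvPolynomial (Fin 3) k :=
  lin fun a b n => X 0 ^ a * X 1 ^ b * (cheb k e (n / e) * X 2 ^ (n % e))

lemma X_zero_mul_mon (a b n : ℕ) : X 0 * mon k a b n = mon k (a + 1) b n := by
  simp only [mon]; ring

lemma X_one_mul_mon (a b n : ℕ) : X 1 * mon k a b n = mon k a (b + 1) n := by
  simp only [mon]; ring

lemma X_two_mul_mon (a b n : ℕ) : X 2 * mon k a b n = mon k a b (n + 1) := by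
  simp only [mon]; ring

lemma mulZ_mon (e a b n : ℕ) : mulZ k e (mon k a b n) = mon k a b (n + 1) +
    if e ∣ n + 1 ∧ 2 * e ≤ n + 1 then mon k (a + e) (b + e) (n + 1 - 2 * e) else 0 :=
  lin_mon _ _ _ _

lemma mulZ_X_zero_mul (e : ℕ) (s : MvPolynomial (Fin 3) k) :
    mulZ k e (X 0 * s) = X 0 * mulZ k e s := by
  refine LinearMap.congr_fun (f := mulZ k e ∘ₗ LinearMap.mulLeft k (X 0))
    (g := LinearMap.mulLeft k (X 0) ∘ₗ mulZ k e) (linearMap_ext fun a b n => ?_) s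
  simp only [LinearMap.comp_apply, LinearMap.mulLeft_apply, X_zero_mul_mon, mulZ_mon, mul_add,
    mul_ite, mul_zero]
  rw [show a + 1 + e = a + e + 1 by ring]

lemma mulZ_X_one_mul (e : ℕ) (s : MvPolynomial (Fin 3) k) :
    mulZ k e (X 1 * s) = X 1 * mulZ k e s := by
  refine LinearMap.congr_fun (f := mulZ k e ∘ₗ LinearMap.mulLeft k (X 1))
    (g := LinearMap.mulLeft k (X 1) ∘ₗ mulZ k e) (linearMap_ext fun a b n => ?_) s
  simp only [LinearMap.comp_apply, LinearMap.mulLeft_apply, X_one_mul_mon, mulZ_mon, mul_add,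
    mul_ite, mul_zero]
  rw [show b + 1 + e = b + e + 1 by ring]

lemma mulZ_pow_mul_pow_mul (e a b : ℕ) (s : MvPolynomial (Fin 3) k) :
    mulZ k e (X 0 ^ a * X 1 ^ b * s) = X 0 ^ a * X 1 ^ b * mulZ k e s := by
  have hb : ∀ t, mulZ k e (X 1 ^ b * t) = X 1 ^ b * mulZ k e t := by
    intro t
    induction b with
    | zero => simp
    | succ b ih => rw [pow_succ', mul_assoc, mulZ_X_one_mul, ih, mul_assoc]
  rw [mul_assoc, mul_assoc, ← hb]
  induction a with
  | zero => simp
  | succ a ih => rw [pow_succ', mul_assoc, mulZ_X_zero_mul, ih, mul_assoc]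

lemma coords_mon (e a b n : ℕ) :
    coords k e (mon k a b n) = X 0 ^ a * X 1 ^ b * ((mulZ k e) ^ n) 1 :=
  lin_mon _ _ _ _

lemma coords_X_zero_mul (e : ℕ) (f : MvPolynomial (Fin 3) k) :
    coords k e (X 0 * f) = X 0 * coords k e f := by
  refine LinearMap.congr_fun (f := coords k e ∘ₗ LinearMap.mulLeft k (X 0))
    (g := LinearMap.mulLeft k (X 0) ∘ₗ coords k e) (linearMap_ext fun a b n => ?_) f
  simp only [LinearMap.comp_apply, LinearMap.mulLeft_apply, X_zero_mul_mon, coords_mon]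
  ring

lemma coords_X_one_mul (e : ℕ) (f : MvPolynomial (Fin 3) k) :
    coords k e (X 1 * f) = X 1 * coords k e f := by
  refine LinearMap.congr_fun (f := coords k e ∘ₗ LinearMap.mulLeft k (X 1))
    (g := LinearMap.mulLeft k (X 1) ∘ₗ coords k e) (linearMap_ext fun a b n => ?_) f
  simp only [LinearMap.comp_apply, LinearMap.mulLeft_apply, X_one_mul_mon, coords_mon]
  ring

lemma coords_X_two_mul (e : ℕ) (f : MvPolynomial (Fin 3) k) :
    coords k e (X 2 * f) = mulZ k e (coords k e f) := by
  refine LinearMap.congr_fun (f := coords k e ∘ₗ LinearMap.mulLeft k (X 2))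
    (g := mulZ k e ∘ₗ coords k e) (linearMap_ext fun a b n => ?_) f
  simp only [LinearMap.comp_apply, LinearMap.mulLeft_apply, X_two_mul_mon, coords_mon,
    mulZ_pow_mul_pow_mul]
  rw [pow_succ', Module.End.mul_apply]

lemma coords_X_zero_pow_mul (e a : ℕ) (f : MvPolynomial (Fin 3) k) :
    coords k e (X 0 ^ a * f) = X 0 ^ a * coords k e f := by
  induction a with
  | zero => simp
  | succ a ih => rw [pow_succ', mul_assoc, coords_X_zero_mul, ih, mul_assoc]

lemma coords_X_one_pow_mul (e b : ℕ) (f : MvPolynomial (Fin 3) k) :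
    coords k e (X 1 ^ b * f) = X 1 ^ b * coords k e f := by
  induction b with
  | zero => simp
  | succ b ih => rw [pow_succ', mul_assoc, coords_X_one_mul, ih, mul_assoc]

lemma coords_X_two_pow_mul (e n : ℕ) (f : MvPolynomial (Fin 3) k) :
    coords k e (X 2 ^ n * f) = ((mulZ k e) ^ n) (coords k e f) := by
  induction n with
  | zero => simp
  | succ n ih => rw [pow_succ', mul_assoc, coords_X_two_mul, ih, pow_succ', Module.End.mul_apply]

lemma coords_one (e : ℕ) : coords k e 1 = 1 := by
  have := coords_mon (k := k) e 0 0 0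
  simpa [mon] using this

lemma mulZ_pow_mon {e t : ℕ} (ht : t < e) (j : ℕ) :
    ((mulZ k e) ^ t) (mon k 0 0 (e * j)) = mon k 0 0 (e * j + t) := by
  induction t with
  | zero => simp
  | succ t ih =>
    rw [pow_succ', Module.End.mul_apply, ih (by omega), mulZ_mon, if_neg, add_zero, add_assoc]
    rintro ⟨h, -⟩
    rw [add_assoc, Nat.dvd_add_right (dvd_mul_right e j)] at h
    exact absurd (Nat.le_of_dvd (by omega) h) (by omega)

lemma mulZ_pow_self_mon {e : ℕ} (he : 1 ≤ e) (j : ℕ) :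
    ((mulZ k e) ^ e) (mon k 0 0 (e * j)) = mon k 0 0 (e * (j + 1)) +
      if 1 ≤ j then mon k e e (e * (j - 1)) else 0 := by
  obtain ⟨t, rfl⟩ : ∃ t, e = t + 1 := ⟨e - 1, by omega⟩
  conv_lhs => rw [pow_succ', Module.End.mul_apply, mulZ_pow_mon (Nat.lt_succ_self t), mulZ_mon]
  have h1 : (t + 1) * j + t + 1 = (t + 1) * (j + 1) := by ring
  rw [h1]
  rcases j with _ | j
  · simp
  · rw [if_pos, if_pos (by omega)]
    · have : (t + 1) * (j + 1 + 1) - 2 * (t + 1) = (t + 1) * j := by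
        rw [show (t + 1) * (j + 1 + 1) = (t + 1) * j + 2 * (t + 1) by ring, Nat.add_sub_cancel]
      simp [this]
    · exact ⟨dvd_mul_right _ _, by nlinarith⟩

lemma coords_cheb {e : ℕ} (he : 1 ≤ e) (j : ℕ) : coords k e (cheb k e j) = mon k 0 0 (e * j) := by
  induction j using Nat.twoStepInduction with
  | zero => simp [cheb, coords_one, mon]
  | one =>
    have := coords_X_two_pow_mul (k := k) e e 1
    have h2 := mulZ_pow_self_mon (k := k) he 0
    simp only [mul_one, coords_one] at this
    simpa [cheb, mon, this] using h2
  | more j ih1 ih2 =>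
    rw [cheb, map_sub, coords_X_two_pow_mul, ih2, mulZ_pow_self_mon he, mul_assoc,
      coords_X_zero_pow_mul, coords_X_one_pow_mul, ih1, if_pos (by omega)]
    simp [mon]
    ring

lemma ofCoords_mon (e a b n : ℕ) : ofCoords k e (mon k a b n) =
    X 0 ^ a * X 1 ^ b * (cheb k e (n / e) * X 2 ^ (n % e)) :=
  lin_mon _ _ _ _

lemma X_two_mul_cheb_mul {e : ℕ} (he : 1 ≤ e) (n : ℕ) :
    X 2 * (cheb k e (n / e) * X 2 ^ (n % e)) =
      cheb k e ((n + 1) / e) * X 2 ^ ((n + 1) % e) +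
        if e ∣ n + 1 ∧ 2 * e ≤ n + 1 then X 0 ^ e * X 1 ^ e *
          (cheb k e ((n + 1 - 2 * e) / e) * X 2 ^ ((n + 1 - 2 * e) % e)) else 0 := by
  by_cases h : e ∣ n + 1
  · obtain ⟨i, hi⟩ := h
    obtain ⟨i, rfl⟩ : ∃ j, i = j + 1 :=
      ⟨i - 1, by rcases i with _ | i <;> simp at hi ⊢⟩
    have hn : n = (e - 1) + e * i := by
      have : e * (i + 1) = e * i + e := by ring
      omega
    have hd : n / e = i := by
      rw [hn, Nat.add_mul_div_left _ _ he, Nat.div_eq_of_lt (by omega), zero_add]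
    have hm : n % e = e - 1 := by
      rw [hn, Nat.add_mul_mod_self_left, Nat.mod_eq_of_lt (by omega)]
    rw [hd, hm, hi, Nat.mul_div_cancel_left _ he, Nat.mul_mod_right]
    rw [mul_left_comm, ← pow_succ', Nat.sub_add_cancel he]
    rcases i with _ | i
    · rw [if_neg (by rintro ⟨-, h⟩; omega)]
      simp [cheb]
    · have h3 : e * (i + 1 + 1) - 2 * e = e * i := by
        rw [show e * (i + 1 + 1) = e * i + 2 * e by ring, Nat.add_sub_cancel]
      rw [if_pos ⟨dvd_mul_right _ _, by nlinarith⟩, h3, Nat.mul_div_cancel_left _ he,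
        Nat.mul_mod_right, cheb]
      ring
  · rw [if_neg (fun h' => h h'.1), add_zero, Nat.succ_div_of_not_dvd h]
    have : (n + 1) % e = n % e + 1 := by
      have h1 := Nat.div_add_mod (n + 1) e
      have h2 := Nat.div_add_mod n e
      rw [Nat.succ_div_of_not_dvd h] at h1
      omega
    rw [this]
    ring

lemma ofCoords_mulZ {e : ℕ} (he : 1 ≤ e) (s : MvPolynomial (Fin 3) k) :
    ofCoords k e (mulZ k e s) = X 2 * ofCoords k e s := by
  refine LinearMap.congr_fun (f := ofCoords k e ∘ₗ mulZ k e)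
    (g := LinearMap.mulLeft k (X 2) ∘ₗ ofCoords k e) (linearMap_ext fun a b n => ?_) s
  simp only [LinearMap.comp_apply, LinearMap.mulLeft_apply, mulZ_mon, map_add, ofCoords_mon]
  rw [mul_left_comm (X 2), X_two_mul_cheb_mul he, mul_add]
  congr 1
  split_ifs
  · rw [ofCoords_mon]; ring
  · simp

lemma ofCoords_pow_mul_pow_mul (e a b : ℕ) (s : MvPolynomial (Fin 3) k) :
    ofCoords k e (X 0 ^ a * X 1 ^ b * s) = X 0 ^ a * X 1 ^ b * ofCoords k e s := by
  have h : ofCoords k e ∘ₗ LinearMap.mulLeft k (X 0 ^ a * X 1 ^ b) =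
      LinearMap.mulLeft k (X 0 ^ a * X 1 ^ b) ∘ₗ ofCoords k e := by
    refine linearMap_ext fun a' b' n => ?_
    have : X 0 ^ a * X 1 ^ b * mon k a' b' n = mon k (a + a') (b + b') n := by
      simp only [mon]; ring
    rw [LinearMap.comp_apply, LinearMap.comp_apply, LinearMap.mulLeft_apply,
      LinearMap.mulLeft_apply, this, ofCoords_mon, ofCoords_mon]
    ring
  exact LinearMap.congr_fun h s

lemma ofCoords_coords {e : ℕ} (he : 1 ≤ e) (f : MvPolynomial (Fin 3) k) :
    ofCoords k e (coords k e f) = f := by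
  refine LinearMap.congr_fun (f := ofCoords k e ∘ₗ coords k e)
    (g := LinearMap.id) (linearMap_ext fun a b n => ?_) f
  have h1 : ofCoords k e 1 = 1 := by
    simpa [mon, cheb] using ofCoords_mon (k := k) e 0 0 0
  have hZ : ofCoords k e (((mulZ k e) ^ n) 1) = X 2 ^ n := by
    induction n with
    | zero => simpa using h1
    | succ n ih => rw [pow_succ', Module.End.mul_apply, ofCoords_mulZ he, ih, pow_succ']
  rw [LinearMap.comp_apply, coords_mon, ofCoords_pow_mul_pow_mul, hZ, LinearMap.id_apply, mon]

lemma coeff_X_zero_mul (s : MvPolynomial (Fin 3) k) (a b n : ℕ) :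
    coeff (expo (a + 1) b n) (X 0 * s) = coeff (expo a b n) s := by
  rw [← coeff_X_mul (expo a b n) 0 s]
  congr 1
  ext i; fin_cases i <;> simp [expo, add_comm]

lemma coeff_X_one_mul (s : MvPolynomial (Fin 3) k) (a b n : ℕ) :
    coeff (expo a (b + 1) n) (X 1 * s) = coeff (expo a b n) s := by
  rw [← coeff_X_mul (expo a b n) 1 s]
  congr 1
  ext i; fin_cases i <;> simp [expo, add_comm]

lemma coeff_mulZ {e : ℕ} (he : 1 ≤ e) (s : MvPolynomial (Fin 3) k) (a b n : ℕ) :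
    coeff (expo a b n) (mulZ k e s) =
      (if 1 ≤ n then coeff (expo a b (n - 1)) s else 0) +
      if e ∣ n ∧ e ≤ a ∧ e ≤ b then coeff (expo (a - e) (b - e) (n + 2 * e - 1)) s else 0 := by
  refine LinearMap.congr_fun (f := lcoeff k (expo a b n) ∘ₗ mulZ k e)
    (g := (if 1 ≤ n then lcoeff k (expo a b (n - 1)) else 0) +
      if e ∣ n ∧ e ≤ a ∧ e ≤ b then lcoeff k (expo (a - e) (b - e) (n + 2 * e - 1)) else 0)
    (linearMap_ext fun a' b' n' => ?_) s |>.trans ?_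
  · have key : (e ∣ n' + 1 ∧ 2 * e ≤ n' + 1) ∧ (a' + e = a ∧ b' + e = b ∧ n' + 1 - 2 * e = n) ↔
        (e ∣ n ∧ e ≤ a ∧ e ≤ b) ∧ (a' = a - e ∧ b' = b - e ∧ n' = n + 2 * e - 1) := by
      constructor
      · rintro ⟨⟨h1, h2⟩, rfl, rfl, rfl⟩
        exact ⟨⟨Nat.dvd_sub h1 (dvd_mul_left e 2), by omega, by omega⟩, by omega, by omega,
          by omega⟩
      · rintro ⟨⟨h1, h2, h3⟩, rfl, rfl, rfl⟩
        rw [Nat.sub_add_cancel (by omega)]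
        exact ⟨⟨(Nat.dvd_add_right h1).2 (dvd_mul_left e 2), by omega⟩, by omega, by omega,
          by omega⟩
    simp only [LinearMap.comp_apply, mulZ_mon, map_add, lcoeff_apply, coeff_mon,
      LinearMap.add_apply]
    congr 1
    · split_ifs <;> first | (exfalso; omega) | simp [coeff_mon] <;> omega
    · by_cases h1 : e ∣ n' + 1 ∧ 2 * e ≤ n' + 1 <;> by_cases h2 : e ∣ n ∧ e ≤ a ∧ e ≤ b <;>
        simp only [h1, h2, true_and, false_and, false_iff, iff_false] at key <;>
        simp [h1, h2, coeff_mon, key]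
  · simp only [LinearMap.add_apply]
    split_ifs <;> simp

/-- The exponents `(a, b, n)` with `x ^ a * y ^ b * z ^ n` occurring in coordinates of elements of
the ideal; here `d` is a multiple of `e`. -/
def IdealExpo (e d a b n : ℕ) : Prop := d + n % e ≤ a + n ∨ d + n % e ≤ b + n

lemma IdealExpo.succ_two {e d a b n : ℕ} (h : IdealExpo e d a b n) : IdealExpo e d a b (n + 1) := by
  have : (n + 1) % e ≤ n % e + 1 := by
    rw [Nat.add_mod]
    exact (Nat.mod_le _ _).trans (Nat.add_le_add_left (Nat.mod_le _ _) _)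
  unfold IdealExpo at *
  omega

lemma sub_one_mod {e n : ℕ} (he : 1 ≤ e) (h : e ∣ n + 1) : n % e = e - 1 := by
  obtain ⟨i, hi⟩ := h
  obtain ⟨i, rfl⟩ : ∃ j, i = j + 1 :=
    ⟨i - 1, by rcases i with _ | i <;> simp at hi ⊢⟩
  have hn : n = (e - 1) + e * i := by
    have : e * (i + 1) = e * i + e := by ring
    omega
  rw [hn, Nat.add_mul_mod_self_left, Nat.mod_eq_of_lt (by omega)]

/-- The space of coordinates of elements of the ideal. -/
def coordSpace (k : Type*) [Field k] (e d : ℕ) : Submodule k (MvPolynomial (Fin 3) k) where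
  carrier := {s | ∀ a b n, coeff (expo a b n) s ≠ 0 → IdealExpo e d a b n}
  add_mem' {s t} hs ht a b n h := by
    by_cases h1 : coeff (expo a b n) s = 0
    · exact ht a b n (by simpa [h1] using h)
    · exact hs a b n h1
  zero_mem' a b n h := by simp at h
  smul_mem' c s hs a b n h := hs a b n fun h0 => h (by simp [h0])

lemma mem_coordSpace {e d : ℕ} {s : MvPolynomial (Fin 3) k} :
    s ∈ coordSpace k e d ↔ ∀ a b n, coeff (expo a b n) s ≠ 0 → IdealExpo e d a b n := Iff.rfl

lemma mon_mem_coordSpace {e d a b n : ℕ} :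
    mon k a b n ∈ coordSpace k e d ↔ IdealExpo e d a b n := by
  refine ⟨fun h => h a b n (by simp [coeff_mon]), fun h a' b' n' hc => ?_⟩
  rw [coeff_mon] at hc
  obtain ⟨rfl, rfl, rfl⟩ : a = a' ∧ b = b' ∧ n = n' := by
    by_contra hne
    exact hc (if_neg hne)
  exact h

lemma X_zero_mul_mem {e d : ℕ} {s : MvPolynomial (Fin 3) k} (hs : s ∈ coordSpace k e d) :
    X 0 * s ∈ coordSpace k e d := by
  intro a b n h
  rcases a with _ | a
  · rw [coeff_X_mul', if_neg (by simp)] at h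
    exact absurd rfl h
  · rw [coeff_X_zero_mul] at h
    have := hs a b n h
    unfold IdealExpo at *
    omega

lemma X_one_mul_mem {e d : ℕ} {s : MvPolynomial (Fin 3) k} (hs : s ∈ coordSpace k e d) :
    X 1 * s ∈ coordSpace k e d := by
  intro a b n h
  rcases b with _ | b
  · rw [coeff_X_mul', if_neg (by simp)] at h
    exact absurd rfl h
  · rw [coeff_X_one_mul] at h
    have := hs a b n h
    unfold IdealExpo at *
    omega

lemma mulZ_mem {e d : ℕ} (he : 1 ≤ e) {s : MvPolynomial (Fin 3) k}
    (hs : s ∈ coordSpace k e d) : mulZ k e s ∈ coordSpace k e d := by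
  intro a b n h
  rw [coeff_mulZ he] at h
  by_cases h1 : 1 ≤ n ∧ coeff (expo a b (n - 1)) s ≠ 0
  · have := (hs a b _ h1.2).succ_two
    rwa [Nat.sub_add_cancel h1.1] at this
  · have h2 : (if 1 ≤ n then coeff (expo a b (n - 1)) s else 0) = 0 := by
      split_ifs with h3
      · by_contra h4
        exact h1 ⟨h3, h4⟩
      · rfl
    rw [h2, zero_add] at h
    obtain ⟨h3, h4⟩ := ite_ne_right_iff.1 h
    have h5 := hs _ _ _ h4
    have h6 : (n + 2 * e - 1) % e = e - 1 := by
      refine sub_one_mod he ?_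
      rw [Nat.sub_add_cancel (by omega)]
      exact (Nat.dvd_add_right h3.1).2 (dvd_mul_left e 2)
    have h7 : n % e = 0 := Nat.mod_eq_zero_of_dvd h3.1
    unfold IdealExpo at *
    omega

/-- The Gorenstein ideal: its elements are those whose coordinates lie in `coordSpace`. -/
noncomputable def gorIdeal (k : Type*) [Field k] {e : ℕ} (he : 1 ≤ e) (d : ℕ) :
    Ideal (MvPolynomial (Fin 3) k) where
  carrier := {f | coords k e f ∈ coordSpace k e d}
  add_mem' {f g} hf hg := by
    simp only [Set.mem_ofPred_eq, map_add] at *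
    exact add_mem hf hg
  zero_mem' := by simp
  smul_mem' c f hf := by
    simp only [Set.mem_ofPred_eq, smul_eq_mul] at *
    induction c using MvPolynomial.induction_on generalizing f with
    | C a =>
      rw [← smul_eq_C_mul, map_smul]
      exact Submodule.smul_mem _ _ hf
    | add p q hp hq =>
      rw [add_mul, map_add]
      exact add_mem (hp f hf) (hq f hf)
    | mul_X p i hp =>
      rw [mul_assoc]
      refine hp _ ?_
      fin_cases i
      · exact (coords_X_zero_mul e f) ▸ X_zero_mul_mem hf
      · exact (coords_X_one_mul e f) ▸ X_one_mul_mem hf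
      · exact (coords_X_two_mul e f) ▸ mulZ_mem he hf

lemma mem_gorIdeal {e d : ℕ} {he : 1 ≤ e} {f : MvPolynomial (Fin 3) k} :
    f ∈ gorIdeal k he d ↔ coords k e f ∈ coordSpace k e d := Iff.rfl

/-- The generators `x ^ (e * w) * q_(m - w)` and `y ^ (e * w) * q_(m - w)` of the ideal. -/
noncomputable def gen (k : Type*) [Field k] (e m : ℕ) :
    Fin (m + 1) ⊕ Fin m → MvPolynomial (Fin 3) k
  | .inl w => X 0 ^ (e * w) * cheb k e (m - w)
  | .inr w => X 1 ^ (e * (w + 1)) * cheb k e (m - (w + 1))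

lemma coords_gen_inl {e m : ℕ} (he : 1 ≤ e) (w : Fin (m + 1)) :
    coords k e (gen k e m (.inl w)) = mon k (e * w) 0 (e * (m - w)) := by
  simp [gen, coords_X_zero_pow_mul, coords_cheb he, mon]

lemma coords_gen_inr {e m : ℕ} (he : 1 ≤ e) (w : Fin m) :
    coords k e (gen k e m (.inr w)) = mon k 0 (e * (w + 1)) (e * (m - (w + 1))) := by
  simp [gen, coords_X_one_pow_mul, coords_cheb he, mon]

lemma gen_mem {e m : ℕ} (he : 1 ≤ e) (i : Fin (m + 1) ⊕ Fin m) :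
    gen k e m i ∈ gorIdeal k he (e * m) := by
  rw [mem_gorIdeal]
  rcases i with ⟨w, hw⟩ | ⟨w, hw⟩
  · rw [coords_gen_inl he, mon_mem_coordSpace]
    left
    rw [Nat.mul_mod_right, ← mul_add, Nat.add_sub_cancel' (by simp; omega), add_zero]
  · rw [coords_gen_inr he, mon_mem_coordSpace]
    right
    rw [Nat.mul_mod_right, ← mul_add, Nat.add_sub_cancel' (by simp; omega), add_zero]

lemma X_zero_pow_mul_cheb_mem_span {e m j a : ℕ} (hj : j ≤ m) (ha : e * (m - j) ≤ a) :
    X 0 ^ a * cheb k e j ∈ Ideal.span (Set.range (gen k e m)) := by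
  have h : gen k e m (.inl ⟨m - j, by omega⟩) ∈ Ideal.span (Set.range (gen k e m)) :=
    Ideal.subset_span ⟨_, rfl⟩
  simp only [gen, Nat.sub_sub_self hj] at h
  obtain ⟨c, rfl⟩ := Nat.exists_eq_add_of_le' ha
  rw [pow_add, mul_assoc]
  exact Ideal.mul_mem_left _ _ h

lemma X_one_pow_mul_cheb_mem_span {e m j b : ℕ} (hj : j ≤ m) (hb : e * (m - j) ≤ b) :
    X 1 ^ b * cheb k e j ∈ Ideal.span (Set.range (gen k e m)) := by
  rcases hj.eq_or_lt with rfl | hj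
  · refine Ideal.mul_mem_left _ _ ?_
    simpa using X_zero_pow_mul_cheb_mem_span (k := k) (e := e) (a := 0) le_rfl (by simp)
  have h : gen k e m (.inr ⟨m - j - 1, by omega⟩) ∈ Ideal.span (Set.range (gen k e m)) :=
    Ideal.subset_span ⟨_, rfl⟩
  simp only [gen, show m - j - 1 + 1 = m - j by omega, Nat.sub_sub_self hj.le] at h
  obtain ⟨c, rfl⟩ := Nat.exists_eq_add_of_le' hb
  rw [pow_add, mul_assoc]
  exact Ideal.mul_mem_left _ _ h

lemma cheb_mem_span {e m : ℕ} (hm : 1 ≤ m) (i : ℕ) :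
    cheb k e (m + i) ∈ Ideal.span (Set.range (gen k e m)) := by
  have h0 : cheb k e m ∈ Ideal.span (Set.range (gen k e m)) := by
    simpa using X_zero_pow_mul_cheb_mem_span (k := k) (e := e) (a := 0) (le_refl m) (by simp)
  induction i using Nat.twoStepInduction with
  | zero => exact h0
  | one =>
    obtain ⟨m, rfl⟩ := Nat.exists_eq_add_of_le' hm
    rw [cheb]
    refine sub_mem (Ideal.mul_mem_left _ _ h0) ?_
    rw [mul_comm (X 0 ^ e), mul_assoc]
    refine Ideal.mul_mem_left _ _ (X_zero_pow_mul_cheb_mem_span (by omega) (by simp))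
  | more i h1 h2 =>
    rw [← add_assoc, cheb]
    exact sub_mem (Ideal.mul_mem_left _ _ h2) (Ideal.mul_mem_left _ _ h1)

lemma ofCoords_mon_mem_span {e m : ℕ} (hm : 1 ≤ m) {a b n : ℕ}
    (h : IdealExpo e (e * m) a b n) :
    ofCoords k e (mon k a b n) ∈ Ideal.span (Set.range (gen k e m)) := by
  rw [ofCoords_mon]
  by_cases hn : m ≤ n / e
  · obtain ⟨c, hc⟩ := Nat.exists_eq_add_of_le hn
    rw [hc]
    exact Ideal.mul_mem_left _ _ (Ideal.mul_mem_right _ _ (cheb_mem_span hm c))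
  · push Not at hn
    have hdm := Nat.div_add_mod n e
    have hsub : e * (m - n / e) = e * m - e * (n / e) := Nat.mul_sub _ _ _
    rcases h with h | h
    · have := X_zero_pow_mul_cheb_mem_span (k := k) (e := e) (a := a) hn.le (by omega)
      convert Ideal.mul_mem_left _ (X 1 ^ b * X 2 ^ (n % e)) this using 1
      ring
    · have := X_one_pow_mul_cheb_mem_span (k := k) (e := e) (b := b) hn.le (by omega)
      convert Ideal.mul_mem_left _ (X 0 ^ a * X 2 ^ (n % e)) this using 1
      ring

lemma gorIdeal_eq_span {e m : ℕ} (he : 1 ≤ e) (hm : 1 ≤ m) :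
    gorIdeal k he (e * m) = Ideal.span (Set.range (gen k e m)) := by
  refine le_antisymm (fun f hf => ?_) (Ideal.span_le.2 ?_)
  · rw [← ofCoords_coords he f, (coords k e f).as_sum, map_sum]
    refine Ideal.sum_mem _ fun v hv => ?_
    have hmon : monomial v (coeff v (coords k e f)) =
        coeff v (coords k e f) • mon k (v 0) (v 1) (v 2) := by
      rw [mon_eq_monomial, expo_self, smul_monomial, smul_eq_mul, mul_one]
    rw [hmon, map_smul, smul_eq_C_mul]
    refine Ideal.mul_mem_left _ _ (ofCoords_mon_mem_span hm (hf _ _ _ ?_))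
    rw [expo_self]
    exact mem_support_iff.1 hv
  · rintro _ ⟨i, rfl⟩
    exact gen_mem he i

lemma isHomogeneous_cheb (e j : ℕ) : (cheb k e j).IsHomogeneous (e * j) := by
  induction j using Nat.twoStepInduction with
  | zero => simpa [cheb] using isHomogeneous_one (Fin 3) k
  | one => simpa [cheb] using (isHomogeneous_X k (2 : Fin 3)).pow e
  | more j h1 h2 =>
    have h3 := ((isHomogeneous_X k (2 : Fin 3)).pow e).mul h2
    have h4 := (((isHomogeneous_X k (0 : Fin 3)).pow e).mul
      ((isHomogeneous_X k (1 : Fin 3)).pow e)).mul h1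
    rw [show 1 * e + e * (j + 1) = e * (j + 2) by ring] at h3
    rw [show 1 * e + 1 * e + e * j = e * (j + 2) by ring] at h4
    exact h3.sub h4

lemma isHomogeneous_gen (e m : ℕ) (i : Fin (m + 1) ⊕ Fin m) :
    (gen k e m i).IsHomogeneous (e * m) := by
  rcases i with ⟨w, hw⟩ | ⟨w, hw⟩
  · have h := ((isHomogeneous_X k (0 : Fin 3)).pow (e * w)).mul (isHomogeneous_cheb e (m - w))
    rwa [one_mul, ← mul_add, Nat.add_sub_cancel' (by omega)] at h
  · have h := ((isHomogeneous_X k (1 : Fin 3)).pow (e * (w + 1))).mul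
      (isHomogeneous_cheb e (m - (w + 1)))
    rwa [one_mul, ← mul_add, Nat.add_sub_cancel' (by omega)] at h

lemma homogeneousComponent_mul_of_isHomogeneous {σ R : Type*} [CommSemiring R] {d : ℕ}
    {g : MvPolynomial σ R} (hg : g.IsHomogeneous d) (c : MvPolynomial σ R) :
    homogeneousComponent d (c * g) = coeff 0 c • g := by
  classical
  induction c using MvPolynomial.induction_on' with
  | monomial v a =>
    have h := (isHomogeneous_monomial a (rfl : v.degree = v.degree)).mul hg
    rw [homogeneousComponent_of_mem ((mem_homogeneousSubmodule _ _).2 h), coeff_monomial]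
    by_cases hv : v = 0
    · subst hv
      simp [smul_eq_C_mul]
    · rw [if_neg hv, if_neg, zero_smul]
      simpa [Finsupp.degree_eq_zero_iff] using hv
  | add p q hp hq => rw [add_mul, map_add, hp, hq, coeff_add, add_smul]

lemma span_inf_homogeneousSubmodule {σ ι R : Type*} [CommRing R] [Fintype ι] {d : ℕ}
    {g : ι → MvPolynomial σ R} (hg : ∀ i, (g i).IsHomogeneous d) :
    (Ideal.span (Set.range g)).restrictScalars R ⊓ homogeneousSubmodule σ R d =
      Submodule.span R (Set.range g) := by
  refine le_antisymm ?_ (Submodule.span_le.2 ?_)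
  · rintro f ⟨hf, hd⟩
    obtain ⟨c, rfl⟩ := (Ideal.mem_span_range_iff_exists_fun).1 hf
    have h := homogeneousComponent_of_mem (m := d) hd
    rw [if_pos rfl, map_sum] at h
    rw [← h]
    refine sum_mem fun i _ => ?_
    rw [homogeneousComponent_mul_of_isHomogeneous (hg i)]
    exact Submodule.smul_mem _ _ (Submodule.subset_span ⟨i, rfl⟩)
  · rintro _ ⟨i, rfl⟩
    exact ⟨Ideal.subset_span ⟨i, rfl⟩, hg i⟩

lemma linearIndependent_gen {e : ℕ} (he : 1 ≤ e) (m : ℕ) :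
    LinearIndependent k (gen k e m) := by
  let E : Fin (m + 1) ⊕ Fin m → (Fin 3 →₀ ℕ)
    | .inl w => expo (e * w) 0 (e * (m - w))
    | .inr w => expo 0 (e * (w + 1)) (e * (m - (w + 1)))
  have hE : Function.Injective E := by
    have h0 : e ≠ 0 := by omega
    rintro (⟨v, hv⟩ | ⟨v, hv⟩) (⟨w, hw⟩ | ⟨w, hw⟩) h <;>
      simp only [E, expo_inj] at h <;> simp_all
  refine LinearIndependent.of_comp (coords k e) ?_
  have : coords k e ∘ gen k e m = basisMonomials (Fin 3) k ∘ E := by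
    funext i
    rcases i with w | w
    · simp [E, coords_gen_inl he, mon_eq_monomial]
    · simp [E, coords_gen_inr he, mon_eq_monomial]
  rw [this]
  exact (basisMonomials (Fin 3) k).linearIndependent.comp E hE

lemma gorIdeal_ne_top {e d : ℕ} (he : 1 ≤ e) (hd : 1 ≤ d) : gorIdeal k he d ≠ ⊤ := by
  rw [Ideal.ne_top_iff_one, mem_gorIdeal, coords_one,
    show (1 : MvPolynomial (Fin 3) k) = mon k 0 0 0 by simp [mon], mon_mem_coordSpace]
  unfold IdealExpo
  omega

lemma cheb_sub_X_two_pow_mem {e : ℕ} (he : 1 ≤ e) (j : ℕ) :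
    cheb k e j - X 2 ^ (e * j) ∈ Ideal.span {(X 0 : MvPolynomial (Fin 3) k)} := by
  induction j using Nat.twoStepInduction with
  | zero => simp [cheb]
  | one => simp [cheb]
  | more j h1 h2 =>
    have h3 : (X 0 : MvPolynomial (Fin 3) k) ^ e ∈ Ideal.span {(X 0 : MvPolynomial (Fin 3) k)} :=
      Ideal.pow_mem_of_mem _ (Ideal.mem_span_singleton_self _) _ he
    convert sub_mem (Ideal.mul_mem_left _ (X 2 ^ e) h2)
      (Ideal.mul_mem_right (X 1 ^ e * cheb k e j) _ h3) using 1
    rw [cheb]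
    ring

lemma mIdeal_le_radical {e m : ℕ} (he : 1 ≤ e) (hm : 1 ≤ m) :
    mIdeal k ≤ (gorIdeal k he (e * m)).radical := by
  have h0 : X 0 ∈ (gorIdeal k he (e * m)).radical := by
    refine ⟨e * m, ?_⟩
    rw [gorIdeal_eq_span he hm]
    simpa [cheb] using X_zero_pow_mul_cheb_mem_span (k := k) (e := e) (Nat.zero_le m) le_rfl
  have h1 : X 1 ∈ (gorIdeal k he (e * m)).radical := by
    refine ⟨e * m, ?_⟩
    rw [gorIdeal_eq_span he hm]
    simpa [cheb] using X_one_pow_mul_cheb_mem_span (k := k) (e := e) (Nat.zero_le m) le_rfl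
  have h2 : X 2 ∈ (gorIdeal k he (e * m)).radical := by
    have hq : cheb k e m ∈ (gorIdeal k he (e * m)).radical := by
      refine Ideal.le_radical ?_
      rw [gorIdeal_eq_span he hm]
      exact cheb_mem_span hm 0
    have hs : cheb k e m - X 2 ^ (e * m) ∈ (gorIdeal k he (e * m)).radical :=
      (Ideal.span_singleton_le_iff_mem _).2 h0 (cheb_sub_X_two_pow_mem he m)
    refine (Ideal.radical_isRadical _) ⟨e * m, ?_⟩
    simpa using sub_mem hq hs
  refine Ideal.span_le.2 ?_
  rintro _ ⟨i, rfl⟩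
  fin_cases i
  · exact h0
  · exact h1
  · exact h2

lemma coords_mon_sub_one {e : ℕ} (he : 1 ≤ e) (a b : ℕ) :
    coords k e (mon k a b (e - 1)) = mon k a b (e - 1) := by
  have h := mulZ_pow_mon (k := k) (show e - 1 < e by omega) 0
  rw [mul_zero, zero_add, show mon k 0 0 0 = 1 by simp [mon]] at h
  rw [coords_mon, h]
  simp [mon]

lemma eq_of_not_idealExpo {e m : ℕ} (he : 1 ≤ e) {s : MvPolynomial (Fin 3) k}
    (h0 : X 0 * s ∈ coordSpace k e (e * m)) (h1 : X 1 * s ∈ coordSpace k e (e * m))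
    (h2 : mulZ k e s ∈ coordSpace k e (e * m)) {a b n : ℕ} (hc : coeff (expo a b n) s ≠ 0)
    (hn : ¬ IdealExpo e (e * m) a b n) : a = e * m - 1 ∧ b = e * m - 1 ∧ n = e - 1 := by
  have hx : ∀ {a b n}, coeff (expo a b n) s ≠ 0 → ¬ IdealExpo e (e * m) a b n →
      a + n + 1 = e * m + n % e ∧ b + n + 1 = e * m + n % e := by
    intro a b n hc hn
    have h3 := h0 (a + 1) b n (by rwa [coeff_X_zero_mul])
    have h4 := h1 a (b + 1) n (by rwa [coeff_X_one_mul])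
    unfold IdealExpo at *
    omega
  have hab := hx hc hn
  have hmod : n % e < e := Nat.mod_lt _ he
  have hdm := Nat.div_add_mod n e
  by_cases hlast : e ∣ n + 1
  · have hne := sub_one_mod he hlast
    by_cases hne' : n = e - 1
    · omega
    exfalso
    have h2e : 2 * e ≤ n + 1 := by
      obtain ⟨i, hi⟩ := hlast
      have : 2 ≤ i := by
        by_contra hlt
        have : i ≤ 1 := by omega
        interval_cases i <;> omega
      nlinarith
    have hdvd : e ∣ n + 1 - 2 * e := Nat.dvd_sub hlast (dvd_mul_left e 2)
    have hm0 : (n + 1 - 2 * e) % e = 0 := Nat.mod_eq_zero_of_dvd hdvd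
    have htarget : ¬ IdealExpo e (e * m) (a + e) (b + e) (n + 1 - 2 * e) := by
      unfold IdealExpo
      omega
    refine htarget (h2 _ _ _ ?_)
    rw [coeff_mulZ he, if_pos (show e ∣ n + 1 - 2 * e ∧ e ≤ a + e ∧ e ≤ b + e from
      ⟨hdvd, by omega, by omega⟩), Nat.add_sub_cancel, Nat.add_sub_cancel,
      Nat.sub_add_cancel h2e, Nat.add_sub_cancel]
    split_ifs with h3
    · have h4 : coeff (expo (a + e) (b + e) (n + 1 - 2 * e - 1)) s = 0 := by
        by_contra h5
        have h6 : (n + 1 - 2 * e - 1) % e = e - 1 :=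
          sub_one_mod he (by rwa [Nat.sub_add_cancel h3])
        have := hx h5 (by unfold IdealExpo; omega)
        omega
      rwa [h4, zero_add]
    · rwa [zero_add]
  · exfalso
    have h3 := h2 a b (n + 1) (by
      rwa [coeff_mulZ he, if_pos (by omega), if_neg (fun h => hlast h.1), add_zero,
        Nat.add_sub_cancel])
    have h4 : (n + 1) % e = n % e + 1 := by
      have h5 := Nat.div_add_mod (n + 1) e
      rw [Nat.succ_div_of_not_dvd hlast] at h5
      omega
    unfold IdealExpo at *
    omega

lemma socDim_gorIdeal {e m : ℕ} (he : 1 ≤ e) (hm : 1 ≤ m) :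
    socDim (gorIdeal k he (e * m)) = 1 := by
  have hpos : e ≤ e * m := Nat.le_mul_of_pos_right e hm
  set I := gorIdeal k he (e * m) with hI
  set u := mon k (e * m - 1) (e * m - 1) (e - 1) with hu
  have hcu : coords k e u = u := coords_mon_sub_one he _ _
  have hmod : (e - 1) % e = e - 1 := Nat.mod_eq_of_lt (by omega)
  have huI : u ∉ I := by
    rw [hI, mem_gorIdeal, hcu, hu, mon_mem_coordSpace, IdealExpo]
    omega
  have hX : ∀ i, X i * u ∈ I := by
    intro i
    rw [hI, mem_gorIdeal]
    fin_cases i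
    · change coords k e (X 0 * u) ∈ _
      rw [coords_X_zero_mul, hcu, hu, X_zero_mul_mon, mon_mem_coordSpace, IdealExpo]
      omega
    · change coords k e (X 1 * u) ∈ _
      rw [coords_X_one_mul, hcu, hu, X_one_mul_mon, mon_mem_coordSpace, IdealExpo]
      omega
    · change coords k e (X 2 * u) ∈ _
      rw [coords_X_two_mul, hcu, hu, mulZ_mon, if_neg (by omega), add_zero, mon_mem_coordSpace,
        IdealExpo, Nat.sub_add_cancel he, Nat.mod_self]
      omega
  have hcolon : ∀ f, f ∈ Submodule.colon I (mIdeal k : Set (MvPolynomial (Fin 3) k)) ↔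
      ∀ i, X i * f ∈ I := by
    intro f
    rw [Submodule.mem_colon]
    refine ⟨fun h i => ?_, fun h p hp => ?_⟩
    · rw [mul_comm]
      exact h _ (Ideal.subset_span ⟨i, rfl⟩)
    · rw [smul_eq_mul]
      refine Submodule.span_induction (p := fun p _ => f * p ∈ I) ?_ (by simp) ?_ ?_ hp
      · rintro _ ⟨i, rfl⟩
        rw [mul_comm]
        exact h i
      · intro p q _ _ hp hq
        rw [mul_add]
        exact add_mem hp hq
      · intro c p _ hp
        rw [smul_eq_mul, mul_left_comm]
        exact Ideal.mul_mem_left _ _ hp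
  have hmap : Submodule.map (Ideal.Quotient.mkₐ k I).toLinearMap
      ((Submodule.colon I (mIdeal k : Set (MvPolynomial (Fin 3) k))).restrictScalars k) =
      Submodule.span k {Ideal.Quotient.mk I u} := by
    refine le_antisymm ?_ ?_
    · rintro _ ⟨f, hf, rfl⟩
      rw [SetLike.mem_coe, Submodule.restrictScalars_mem, hcolon] at hf
      set c := coeff (expo (e * m - 1) (e * m - 1) (e - 1)) (coords k e f) with hc
      have hg : ∀ i, X i * (f - c • u) ∈ I := by
        intro i
        rw [mul_sub, mul_smul_comm, smul_eq_C_mul]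
        exact sub_mem (hf i) (Ideal.mul_mem_left _ _ (hX i))
      have hfu : f - c • u ∈ I := by
        rw [hI, mem_gorIdeal]
        intro a b n hne
        by_contra hn
        have h0 := hg 0
        have h1 := hg 1
        have h2 := hg 2
        rw [hI, mem_gorIdeal] at h0 h1 h2
        rw [coords_X_zero_mul] at h0
        rw [coords_X_one_mul] at h1
        rw [coords_X_two_mul] at h2
        obtain ⟨rfl, rfl, rfl⟩ := eq_of_not_idealExpo he h0 h1 h2 hne hn
        refine hne ?_
        rw [map_sub, map_smul, hcu, coeff_sub, coeff_smul, ← hc, hu, coeff_mon,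
          if_pos ⟨rfl, rfl, rfl⟩]
        simp
      refine Submodule.mem_span_singleton.2 ⟨c, ?_⟩
      have := Ideal.Quotient.eq.2 hfu
      change c • Ideal.Quotient.mkₐ k I u = Ideal.Quotient.mkₐ k I f
      rw [← map_smul]
      exact this.symm
    · rw [Submodule.span_singleton_le_iff_mem]
      exact ⟨u, (hcolon u).2 hX, rfl⟩
  rw [socDim, hmap]
  exact finrank_span_singleton fun h => huI (Ideal.Quotient.eq_zero_iff_mem.1 h)

end GorensteinChebyshev

/-- Every equigenerated Gorenstein virtual datum `(d, r)` (with `d ≥ 2`, `r ≥ 3` odd and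
`(r−1)/2 ∣ d`) is proper in `k[x,y,z]`, over any field: there exists a proper homogeneous
`𝔪`-primary ideal `I` generated by its degree-`d` component with `dim_k I_d = r` and
1-dimensional socle. -/
theorem stmt9 (k : Type*) [Field k] (d r : ℕ) (hd : 2 ≤ d) (hr : 3 ≤ r) (hodd : Odd r)
    (hdvd : (r - 1) / 2 ∣ d) :
    ∃ I : Ideal (MvPolynomial (Fin 3) k),
      I ≠ ⊤
      ∧ (∃ N : ℕ, 1 ≤ N ∧ (mIdeal k) ^ N ≤ I)
      ∧ I = Ideal.span
          ((I.restrictScalars k ⊓ homogeneousSubmodule (Fin 3) k d : Submodule k _) : Set _)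
      ∧ Module.finrank k ↥(I.restrictScalars k ⊓ homogeneousSubmodule (Fin 3) k d) = r
      ∧ socDim I = 1 := by
  obtain ⟨e, rfl⟩ := hdvd
  obtain ⟨m, rfl⟩ := hodd
  rw [show (2 * m + 1 - 1) / 2 = m by omega] at *
  have hm : 1 ≤ m := by omega
  have he : 1 ≤ e := Nat.pos_of_ne_zero (by rintro rfl; omega)
  rw [mul_comm m e] at *
  have hspan := GorensteinChebyshev.gorIdeal_eq_span (k := k) he hm
  have hdeg : (GorensteinChebyshev.gorIdeal k he (e * m)).restrictScalars k ⊓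
      homogeneousSubmodule (Fin 3) k (e * m) =
        Submodule.span k (Set.range (GorensteinChebyshev.gen k e m)) := by
    rw [hspan]
    exact GorensteinChebyshev.span_inf_homogeneousSubmodule
      (GorensteinChebyshev.isHomogeneous_gen e m)
  refine ⟨GorensteinChebyshev.gorIdeal k he (e * m),
    GorensteinChebyshev.gorIdeal_ne_top he (by omega), ?_, ?_, ?_,
    GorensteinChebyshev.socDim_gorIdeal he hm⟩
  · obtain ⟨N, hN⟩ := Ideal.exists_pow_le_of_le_radical_of_fg
      (GorensteinChebyshev.mIdeal_le_radical (k := k) he hm) (IsNoetherian.noetherian _)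
    exact ⟨N + 1, by omega, (Ideal.pow_le_pow_right N.le_succ).trans hN⟩
  · refine le_antisymm ?_ (Ideal.span_le.2 fun f hf => hf.1)
    rw [hdeg]
    conv_lhs => rw [hspan]
    exact Ideal.span_mono Submodule.subset_span
  · rw [hdeg, finrank_span_eq_card (GorensteinChebyshev.linearIndependent_gen he m)]
    simp
    omega
end
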